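/- arXiv:2312.16961 — 4 statements merged into one kernel-verified Lean document; each statement's English description precedes it below -/
import Mathlib

section
/- Let d = m + n ≥ 2, let ω be an (m,n)-weight vector, let a ∈ ℝ, and let W ⊂ ℝ^d be a k-dimensional linear subspace for some k ∈ {1,…,d−1}. Then the set {x ∈ M_{m,n}(ℝ) : ψ(ker x̃ ∩ W) ≥ a} is Zariski closed in M_{m,n}(ℝ). -/
open scoped Classical
open MeasureTheory Module Matrix

noncomputable section

/-- The set of integer vectors in `ℝ^d`. -/
def intVectors (d : ℕ) : Set (Fin d → ℝ) :=
  Set.range fun z : Fin d → ℤ => fun i => (z i : ℝ)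

/-- The lattice `g ℤ^d`. -/
def latticeOf {d : ℕ} (g : Matrix (Fin d) (Fin d) ℝ) : Set (Fin d → ℝ) :=
  g.mulVec '' intVectors d

/-- The `i`-th successive minimum of a lattice `Λ ⊆ ℝ^d` with respect to the closed unit
cube (the sup-norm unit ball): the least `r > 0` such that `r C` contains `i` linearly
independent vectors of `Λ`. -/
def succMin (d : ℕ) (Λ : Set (Fin d → ℝ)) (i : ℕ) : ℝ :=
  sInf {r : ℝ | 0 < r ∧ ∃ v : Fin i → (Fin d → ℝ),
    (∀ j, v j ∈ Λ) ∧ LinearIndependent ℝ v ∧ ∀ j, ‖v j‖ ≤ r}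

/-- `ω` is an `(m,n)`-weight vector. -/
def IsWeightVector (m n : ℕ) (ω : Fin (m + n) → ℝ) : Prop :=
  (∀ i, 0 < ω i) ∧
  (∀ i j : Fin (m + n), i ≤ j → (j : ℕ) < m → ω j ≤ ω i) ∧
  (∀ i j : Fin (m + n), m ≤ (i : ℕ) → i ≤ j → ω j ≤ ω i) ∧
  (∑ i ∈ Finset.univ.filter (fun i : Fin (m + n) => (i : ℕ) < m), ω i) = 1 ∧
  (∑ i ∈ Finset.univ.filter (fun i : Fin (m + n) => m ≤ (i : ℕ)), ω i) = 1

/-- The signed weight: `ω i` for `i < m` (expanding directions) and `-ω i` for `i ≥ m`. -/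
def signedWeight (m : ℕ) {d : ℕ} (ω : Fin d → ℝ) (i : Fin d) : ℝ :=
  if (i : ℕ) < m then ω i else -ω i

/-- The diagonal flow `a_t^ω = diag (e^{ω₁ t}, …, e^{ω_m t}, e^{-ω_{m+1} t}, …, e^{-ω_d t})`. -/
def aMat (m : ℕ) {d : ℕ} (ω : Fin d → ℝ) (t : ℝ) : Matrix (Fin d) (Fin d) ℝ :=
  Matrix.diagonal fun i => Real.exp (signedWeight m ω i * t)

/-- `L_i^ω(Λ, t) = log λ_i (a_t^ω Λ)`. -/
def Lfun (m : ℕ) {d : ℕ} (ω : Fin d → ℝ) (Λ : Set (Fin d → ℝ)) (i : ℕ) (t : ℝ) : ℝ :=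
  Real.log (succMin d ((aMat m ω t).mulVec '' Λ) i)

/-- `L^ω(Λ, ⬝)` is connected at `k`: the set `{t ≥ 0 : L_k = L_{k+1}}` is unbounded above. -/
def ConnectedAt (m : ℕ) {d : ℕ} (ω : Fin d → ℝ) (Λ : Set (Fin d → ℝ)) (k : ℕ) : Prop :=
  ∀ T : ℝ, ∃ t : ℝ, 0 ≤ t ∧ T ≤ t ∧ Lfun m ω Λ k t = Lfun m ω Λ (k + 1) t

/-- `μ_I = ∑_{i ∈ I, i ≤ m} ω_i - ∑_{i ∈ I, i ≥ m+1} ω_i`. -/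
def muI (m : ℕ) {d : ℕ} (ω : Fin d → ℝ) (I : Finset (Fin d)) : ℝ :=
  ∑ i ∈ I, signedWeight m ω i

/-- The orthogonal projection `π_I : ℝ^d → ℝ^I`. -/
def coordProj (d : ℕ) (I : Finset (Fin d)) : (Fin d → ℝ) →ₗ[ℝ] (Fin d → ℝ) where
  toFun v := fun i => if i ∈ I then v i else 0
  map_add' u v := by funext i; by_cases h : i ∈ I <;> simp [h]
  map_smul' c v := by funext i; by_cases h : i ∈ I <;> simp [h]

/-- The coordinate subspace `ℝ^I = span {e_i : i ∈ I}`. -/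
def coordSubspace (d : ℕ) (I : Finset (Fin d)) : Submodule ℝ (Fin d → ℝ) :=
  Submodule.span ℝ {v | ∃ i ∈ I, v = Pi.single i (1 : ℝ)}

/-- The coefficient of `e_I` in `w 0 ∧ ⋯ ∧ w (k-1) ∈ ⋀^k ℝ^d`, i.e. the `I`-rows minor
`det (w_{j i})_{j ∈ I, 1 ≤ i ≤ k}`. -/
def gramCoeff {d k : ℕ} (w : Fin k → Fin d → ℝ) (I : Finset (Fin d)) : ℝ :=
  if h : I.card = k then
    Matrix.det (Matrix.of fun r c : Fin k => w c (I.orderEmbOfFin h r))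
  else 0

/-- The minor `det A(I, J)` of a square matrix. -/
def subDet {d : ℕ} (A : Matrix (Fin d) (Fin d) ℝ) (k : ℕ) (I J : Finset (Fin d)) : ℝ :=
  if h : I.card = k ∧ J.card = k then
    Matrix.det (Matrix.of fun r c : Fin k => A (I.orderEmbOfFin h.1 r) (J.orderEmbOfFin h.2 c))
  else 0

/-- The largest eigenvalue of `a_1^ω` appearing in the decomposition of
`w 0 ∧ ⋯ ∧ w (k-1)` into eigenvectors of `a_1^ω` in `⋀^k ℝ^d`. -/
def largestEigAlong (m : ℕ) {d k : ℕ} (ω : Fin d → ℝ) (w : Fin k → Fin d → ℝ) : ℝ :=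
  sSup {r : ℝ | ∃ I : Finset (Fin d), I.card = k ∧ gramCoeff w I ≠ 0 ∧ r = Real.exp (muI m ω I)}

/-- `E_j = span (e_1, …, e_j)` (the first `j` coordinates, 0-indexed internally). -/
def Espan (d : ℕ) (j : ℕ) : Submodule ℝ (Fin d → ℝ) :=
  Submodule.span ℝ {v | ∃ i : Fin d, (i : ℕ) < j ∧ v = Pi.single i (1 : ℝ)}

/-- `E'_{j+1} = span (e_{j+1}, …, e_m)` (0-indexed: coordinates `≥ j`). -/
def Eprime (m : ℕ) (j : ℕ) : Submodule ℝ (Fin m → ℝ) :=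
  Submodule.span ℝ {v | ∃ i : Fin m, j ≤ (i : ℕ) ∧ v = Pi.single i (1 : ℝ)}

/-- `I(W) = {i ∈ {m+1,…,d} : dim (W ∩ E_i) > dim (W ∩ E_{i-1})}`. -/
def Iset (m : ℕ) {d : ℕ} (W : Submodule ℝ (Fin d → ℝ)) : Finset (Fin d) :=
  Finset.univ.filter fun i : Fin d =>
    m ≤ (i : ℕ) ∧
      finrank ℝ ↥(W ⊓ Espan d (i : ℕ)) < finrank ℝ ↥(W ⊓ Espan d ((i : ℕ) + 1))

/-- `ψ(W) = ∑_{i ∈ I(W)} ω_i`. -/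
def psiF (m : ℕ) {d : ℕ} (ω : Fin d → ℝ) (W : Submodule ℝ (Fin d → ℝ)) : ℝ :=
  ∑ i ∈ Iset m W, ω i

/-- `J(W') = {j ∈ {1,…,m} : dim (W' ∩ ⟨e_{j+1},…,e_m⟩) < dim (W' ∩ ⟨e_j,…,e_m⟩)}`. -/
def Jset {m : ℕ} (W' : Submodule ℝ (Fin m → ℝ)) : Finset (Fin m) :=
  Finset.univ.filter fun j : Fin m =>
    finrank ℝ ↥(W' ⊓ Eprime m ((j : ℕ) + 1)) < finrank ℝ ↥(W' ⊓ Eprime m (j : ℕ))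

/-- `φ(W') = ∑_{j ∈ J(W')} ω_j`. -/
def phiF (m n : ℕ) (ω : Fin (m + n) → ℝ) (W' : Submodule ℝ (Fin m → ℝ)) : ℝ :=
  ∑ j ∈ Jset W', ω (Fin.castAdd n j)

/-- `u(x) = [[Iₘ, x], [0, Iₙ]]`. -/
def uMat (m n : ℕ) (x : Matrix (Fin m) (Fin n) ℝ) : Matrix (Fin (m + n)) (Fin (m + n)) ℝ :=
  Matrix.reindex finSumFinEquiv finSumFinEquiv (Matrix.fromBlocks 1 x 0 1)

/-- `x̃ ∈ M_{m,d}(ℝ)`: the first `m` rows of `u(x)`. -/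
def xTil (m n : ℕ) (x : Matrix (Fin m) (Fin n) ℝ) : Matrix (Fin m) (Fin (m + n)) ℝ :=
  Matrix.of fun i j => uMat m n x (Fin.castAdd n i) j

/-- `ker x̃` as a subspace of `ℝ^d`. -/
def kerXtil (m n : ℕ) (x : Matrix (Fin m) (Fin n) ℝ) : Submodule ℝ (Fin (m + n) → ℝ) :=
  LinearMap.ker (xTil m n x).mulVecLin

/-- The `k`-pencil `P^ω_{W,a,b} = {x : ψ(ker x̃ ∩ W) ≥ a ∧ φ(x̃ W) ≤ b}`. -/
def pencil (m n : ℕ) (ω : Fin (m + n) → ℝ) (W : Submodule ℝ (Fin (m + n) → ℝ)) (a b : ℝ) :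
    Set (Matrix (Fin m) (Fin n) ℝ) :=
  {x | a ≤ psiF m ω (kerXtil m n x ⊓ W) ∧ phiF m n ω (W.map (xTil m n x).mulVecLin) ≤ b}

/-- A subspace of `ℝ^d` is rational (defined over `ℚ`) if it is spanned by rational vectors. -/
def IsRationalSubspace {d : ℕ} (W : Submodule ℝ (Fin d → ℝ)) : Prop :=
  ∃ S : Set (Fin d → ℚ),
    Submodule.span ℝ ((fun q : Fin d → ℚ => fun i => ((q i : ℝ))) '' S) = W

/-- A subset of `M_{m,n}(ℝ)` is Zariski closed if it is the common zero locus of a set of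
real polynomials in the matrix entries. -/
def IsZariskiClosed {m n : ℕ} (S : Set (Matrix (Fin m) (Fin n) ℝ)) : Prop :=
  ∃ P : Set (MvPolynomial (Fin m × Fin n) ℝ),
    S = {x | ∀ p ∈ P, MvPolynomial.eval (fun ij => x ij.1 ij.2) p = 0}

/-- View a point of Euclidean space indexed by matrix entries as a matrix. -/
def matOfEuc (m n : ℕ) (z : EuclideanSpace ℝ (Fin m × Fin n)) : Matrix (Fin m) (Fin n) ℝ :=
  Matrix.of fun i j => z (i, j)

/-- `M` is a `p`-dimensional analytic submanifold: around every point, `M` agrees with the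
image of an injective analytic immersion of an open subset of `ℝ^p`. -/
def IsAnalyticSubmanifold {ι : Type*} [Fintype ι] (p : ℕ) (M : Set (EuclideanSpace ℝ ι)) :
    Prop :=
  ∀ z ∈ M, ∃ (U : Set (EuclideanSpace ℝ (Fin p)))
      (f : EuclideanSpace ℝ (Fin p) → EuclideanSpace ℝ ι) (V : Set (EuclideanSpace ℝ ι)),
    IsOpen U ∧ IsOpen V ∧ z ∈ V ∧ AnalyticOnNhd ℝ f U ∧ Set.InjOn f U ∧
      (∀ u ∈ U, Function.Injective (fderiv ℝ f u)) ∧ f '' U = M ∩ V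

/-- A column matrix from a vector. -/
def colMat (m : ℕ) (ξ : Fin m → ℝ) : Matrix (Fin m) (Fin 1) ℝ :=
  Matrix.of fun i _ => ξ i

/-- A row matrix from a vector. -/
def rowMat (n : ℕ) (ξ : Fin n → ℝ) : Matrix (Fin 1) (Fin n) ℝ :=
  Matrix.of fun _ j => ξ j

/-- The minor of `x` with rows `P` and columns `Q`. -/
def minorDet (m n : ℕ) (x : Matrix (Fin m) (Fin n) ℝ) (P : Finset (Fin m))
    (Q : Finset (Fin n)) (h : P.card = Q.card) : ℝ :=
  Matrix.det (Matrix.of fun r c : Fin P.card =>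
    x (P.orderEmbOfFin rfl r) (Q.orderEmbOfFin h.symm c))

/-- `𝓓(𝓡)`: the set of all `p × p` minors of `x` with increasing rows in `{1,…,m}` and
increasing columns in `𝓡`, for `1 ≤ p ≤ min m (d - k)`. -/
def Dset (m n k : ℕ) (x : Matrix (Fin m) (Fin n) ℝ) (R : Finset (Fin n)) : Set ℝ :=
  {r | ∃ (P : Finset (Fin m)) (Q : Finset (Fin n)) (h : P.card = Q.card),
    Q ⊆ R ∧ 1 ≤ P.card ∧ P.card ≤ min m (m + n - k) ∧ r = minorDet m n x P Q h}


/-- The matrix `x̃` of a generic `x`, with entries in the polynomial ring. -/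
def genericXTil (m n : ℕ) : Matrix (Fin m) (Fin (m + n)) (MvPolynomial (Fin m × Fin n) ℝ) :=
  Matrix.of fun i j => Sum.elim (fun k => if i = k then 1 else 0)
    (fun k => MvPolynomial.X (i, k)) (finSumFinEquiv.symm j)

lemma xTil_apply (m n : ℕ) (x : Matrix (Fin m) (Fin n) ℝ) (i : Fin m) (j : Fin (m + n)) :
    xTil m n x i j = Sum.elim (fun k => if i = k then 1 else 0) (x i) (finSumFinEquiv.symm j) := by
  rcases h : finSumFinEquiv.symm j with k | k <;>
    simp [xTil, uMat, h, Matrix.one_apply]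

lemma eval_genericXTil (m n : ℕ) (x : Matrix (Fin m) (Fin n) ℝ) :
    (genericXTil m n).map (MvPolynomial.eval fun ij => x ij.1 ij.2) = xTil m n x := by
  ext i j
  rw [Matrix.map_apply, xTil_apply, genericXTil, Matrix.of_apply]
  rcases finSumFinEquiv.symm j with k | k <;> simp [apply_ite]

namespace IsZariskiClosed

variable {m n : ℕ} {S T : Set (Matrix (Fin m) (Fin n) ℝ)}

lemma empty : IsZariskiClosed (∅ : Set (Matrix (Fin m) (Fin n) ℝ)) :=
  ⟨{1}, by simp⟩

lemma iInter {ι : Sort*} {S : ι → Set (Matrix (Fin m) (Fin n) ℝ)}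
    (h : ∀ i, IsZariskiClosed (S i)) : IsZariskiClosed (⋂ i, S i) := by
  choose P hP using h
  refine ⟨⋃ i, P i, ?_⟩
  ext x
  simp only [hP, Set.mem_iInter, Set.mem_ofPred_eq, Set.mem_iUnion]
  exact ⟨fun h p ⟨i, hi⟩ => h i p hi, fun h i p hp => h p ⟨i, hp⟩⟩

lemma union (hS : IsZariskiClosed S) (hT : IsZariskiClosed T) : IsZariskiClosed (S ∪ T) := by
  obtain ⟨P, rfl⟩ := hS
  obtain ⟨Q, rfl⟩ := hT
  refine ⟨Set.image2 (· * ·) P Q, ?_⟩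
  ext x
  simp only [Set.mem_union, Set.mem_ofPred_eq, Set.forall_mem_image2, map_mul, mul_eq_zero]
  constructor
  · rintro (h | h) p hp q hq
    exacts [.inl (h p hp), .inr (h q hq)]
  · intro h
    by_contra! ⟨⟨p, hp, hp0⟩, q, hq, hq0⟩
    exact (h p hp q hq).elim hp0 hq0

lemma biUnion {ι : Type*} {s : Set ι} (hs : s.Finite)
    {S : ι → Set (Matrix (Fin m) (Fin n) ℝ)} (h : ∀ i ∈ s, IsZariskiClosed (S i)) :
    IsZariskiClosed (⋃ i ∈ s, S i) := by
  induction s, hs using Set.Finite.induction_on with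
  | empty => simpa using IsZariskiClosed.empty
  | insert _ _ ih =>
    rw [Set.biUnion_insert]
    exact (h _ (Set.mem_insert _ _)).union (ih fun i hi => h i (Set.mem_insert_of_mem _ hi))

end IsZariskiClosed

lemma finrank_inf_ker_add_finrank_map {K V V' : Type*} [Field K] [AddCommGroup V] [Module K V]
    [AddCommGroup V'] [Module K V'] [FiniteDimensional K V] (U : Submodule K V) (f : V →ₗ[K] V') :
    finrank K ↥(U ⊓ LinearMap.ker f) + finrank K ↥(U.map f) = finrank K U := by
  rw [← (f.domRestrict U).finrank_range_add_finrank_ker, LinearMap.range_domRestrict, add_comm,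
    LinearMap.ker_domRestrict, ← Submodule.finrank_map_subtype_eq U, Submodule.map_comap_subtype]

lemma mem_Espan {d j : ℕ} {v : Fin d → ℝ} :
    v ∈ Espan d j ↔ ∀ i : Fin d, j ≤ (i : ℕ) → v i = 0 := by
  constructor
  · intro hv i hi
    have : Espan d j ≤ LinearMap.ker (LinearMap.proj (R := ℝ) (φ := fun _ : Fin d => ℝ) i) := by
      refine Submodule.span_le.2 ?_
      rintro _ ⟨k, hk, rfl⟩
      have : i ≠ k := by rintro rfl; omega
      simp [this]
    exact this hv
  · intro h
    rw [pi_eq_sum_univ' v]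
    refine Submodule.sum_mem _ fun i _ => ?_
    by_cases hi : j ≤ (i : ℕ)
    · simp [h i hi]
    · refine Submodule.smul_mem _ _ (Submodule.subset_span ⟨i, by omega, ?_⟩)
      ext k
      simp [Pi.single_apply, eq_comm]

lemma finrank_inf_Espan_succ_le {d : ℕ} (V : Submodule ℝ (Fin d → ℝ)) (i : Fin d) :
    finrank ℝ ↥(V ⊓ Espan d (i + 1)) ≤ finrank ℝ ↥(V ⊓ Espan d i) + 1 := by
  let f : (Fin d → ℝ) →ₗ[ℝ] ℝ := LinearMap.proj i
  have h : V ⊓ Espan d (i + 1) ⊓ LinearMap.ker f = V ⊓ Espan d i := by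
    ext v
    simp only [Submodule.mem_inf, mem_Espan, LinearMap.mem_ker, and_assoc, f, LinearMap.proj_apply]
    refine and_congr_right fun _ => ⟨fun ⟨h, h'⟩ k hk => ?_, fun h => ⟨fun k hk => h k (by omega),
      h i le_rfl⟩⟩
    rcases hk.eq_or_lt with hk | hk
    · rwa [← Fin.ext hk]
    · exact h k hk
  rw [← finrank_inf_ker_add_finrank_map _ f, h]
  gcongr
  simpa using Submodule.finrank_le ((V ⊓ Espan d (i + 1)).map f)

lemma finrank_inf_Espan_mono {d : ℕ} (V : Submodule ℝ (Fin d → ℝ)) {i j : ℕ} (h : i ≤ j) :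
    finrank ℝ ↥(V ⊓ Espan d i) ≤ finrank ℝ ↥(V ⊓ Espan d j) :=
  Submodule.finrank_mono <| inf_le_inf_left _ fun _ hv =>
    mem_Espan.2 fun k hk => mem_Espan.1 hv k (h.trans hk)

lemma xTil_mulVec_of_mem_Espan {m n : ℕ} (x : Matrix (Fin m) (Fin n) ℝ) {v : Fin (m + n) → ℝ}
    (hv : v ∈ Espan (m + n) m) (i : Fin m) : (xTil m n x *ᵥ v) i = v (Fin.castAdd n i) := by
  rw [mem_Espan] at hv
  simp [Matrix.mulVec, dotProduct, Fin.sum_univ_add, xTil_apply, hv]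

lemma kerXtil_inf_Espan (m n : ℕ) (x : Matrix (Fin m) (Fin n) ℝ) :
    kerXtil m n x ⊓ Espan (m + n) m = ⊥ := by
  refine (Submodule.eq_bot_iff _).2 fun v ⟨hv, hv'⟩ => funext fun j => ?_
  refine Fin.addCases (fun i => ?_) (fun i => mem_Espan.1 hv' _ (by simp)) j
  rw [← xTil_mulVec_of_mem_Espan x hv']
  exact congrFun (show xTil m n x *ᵥ v = 0 from hv) i

lemma exists_det_ne_zero_of_le_finrank_map {m d s : ℕ} (A : Matrix (Fin m) (Fin d) ℝ)
    (U : Submodule ℝ (Fin d → ℝ)) (h : s ≤ finrank ℝ ↥(U.map A.mulVecLin)) :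
    ∃ (L : Matrix (Fin s) (Fin m) ℝ) (B : Matrix (Fin d) (Fin s) ℝ),
      (∀ j, B.col j ∈ U) ∧ (L * A * B).det ≠ 0 := by
  obtain ⟨w, hw⟩ := exists_linearIndependent_of_le_finrank h
  choose u hu huw using fun j => (w j).2
  let B : Matrix (Fin d) (Fin s) ℝ := Matrix.of fun i j => u j i
  have hli : LinearIndependent ℝ (A * B).col := by
    have : (A * B).col = fun j => (w j : Fin m → ℝ) := by
      ext j i
      rw [← huw j]
      rfl
    rw [this]
    exact hw.map' (Submodule.subtype _) (Submodule.ker_subtype _)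
  obtain ⟨g, hg⟩ := (Matrix.toLin' (A * B)).exists_leftInverse_of_injective
    (LinearMap.ker_eq_bot.2 (Matrix.mulVec_injective_iff.2 hli))
  have hL : LinearMap.toMatrix' g * (A * B) = 1 := by
    rw [← LinearMap.toMatrix'_toLin' (A * B), ← LinearMap.toMatrix'_comp, hg,
      LinearMap.toMatrix'_id]
  exact ⟨LinearMap.toMatrix' g, B, hu, by simp [Matrix.mul_assoc, hL]⟩

lemma le_finrank_map_of_det_ne_zero {m d s : ℕ} {A : Matrix (Fin m) (Fin d) ℝ}
    {U : Submodule ℝ (Fin d → ℝ)} {L : Matrix (Fin s) (Fin m) ℝ} {B : Matrix (Fin d) (Fin s) ℝ}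
    (hB : ∀ j, B.col j ∈ U) (h : (L * A * B).det ≠ 0) :
    s ≤ finrank ℝ ↥(U.map A.mulVecLin) := by
  calc s = (L * (A * B)).rank := by
        rw [← Matrix.mul_assoc, Matrix.rank_of_isUnit _ ((Matrix.isUnit_iff_isUnit_det _).2
          h.isUnit), Fintype.card_fin]
    _ ≤ (A * B).rank := Matrix.rank_mul_le_right _ _
    _ ≤ _ := by
      refine Submodule.finrank_mono ?_
      rw [Matrix.mulVecLin_mul, LinearMap.range_comp, Matrix.range_mulVecLin]
      refine Submodule.map_mono (Submodule.span_le.2 ?_)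
      rintro _ ⟨j, rfl⟩
      exact hB j

/-- The determinant of `L * x̃ * B` as a polynomial in the entries of `x`. -/
def detPoly {m n s : ℕ} (L : Matrix (Fin s) (Fin m) ℝ) (B : Matrix (Fin (m + n)) (Fin s) ℝ) :
    MvPolynomial (Fin m × Fin n) ℝ :=
  Matrix.det ((L.map MvPolynomial.C : Matrix _ _ (MvPolynomial (Fin m × Fin n) ℝ)) *
    genericXTil m n * (B.map MvPolynomial.C : Matrix _ _ (MvPolynomial (Fin m × Fin n) ℝ)))

lemma eval_detPoly {m n s : ℕ} (x : Matrix (Fin m) (Fin n) ℝ) (L : Matrix (Fin s) (Fin m) ℝ)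
    (B : Matrix (Fin (m + n)) (Fin s) ℝ) :
    MvPolynomial.eval (fun ij => x ij.1 ij.2) (detPoly L B) = (L * xTil m n x * B).det := by
  rw [detPoly, RingHom.map_det, RingHom.mapMatrix_apply, Matrix.map_mul, Matrix.map_mul,
    eval_genericXTil]
  simp [Matrix.map_map, Function.comp_def]

lemma isZariskiClosed_le_finrank_kerXtil_inf {m n : ℕ} (U : Submodule ℝ (Fin (m + n) → ℝ))
    (c : ℕ) : IsZariskiClosed {x | c ≤ finrank ℝ ↥(kerXtil m n x ⊓ U)} := by
  have key (x : Matrix (Fin m) (Fin n) ℝ) := finrank_inf_ker_add_finrank_map U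
    (xTil m n x).mulVecLin
  by_cases hc : c ≤ finrank ℝ U
  · let s := finrank ℝ U - c + 1
    refine ⟨{p | ∃ (L : Matrix (Fin s) (Fin m) ℝ) (B : Matrix (Fin (m + n)) (Fin s) ℝ),
      (∀ j, B.col j ∈ U) ∧ p = detPoly L B}, ?_⟩
    ext x
    specialize key x
    rw [inf_comm] at key
    change finrank ℝ ↥(kerXtil m n x ⊓ U) + _ = _ at key
    simp only [Set.mem_ofPred_eq]
    constructor
    · rintro hx _ ⟨L, B, hB, rfl⟩
      rw [eval_detPoly]
      by_contra h
      have := le_finrank_map_of_det_ne_zero hB h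
      omega
    · intro h
      by_contra! hx
      obtain ⟨L, B, hB, hdet⟩ := exists_det_ne_zero_of_le_finrank_map (s := s) (xTil m n x) U
        (by omega)
      exact hdet (eval_detPoly x L B ▸ h _ ⟨L, B, hB, rfl⟩)
  · convert IsZariskiClosed.empty
    refine Set.eq_empty_of_forall_notMem fun x hx => hc (le_trans hx ?_)
    exact Submodule.finrank_mono inf_le_right

lemma sum_range_mul_sub_eq (w D : ℕ → ℝ) (n : ℕ) :
    ∑ i ∈ Finset.range n, w i * (D (i + 1) - D i) =
      ∑ i ∈ Finset.range n, (w i - w (i + 1)) * D (i + 1) + w n * D n - w 0 * D 0 := by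
  induction n with
  | zero => simp
  | succ n ih =>
    rw [Finset.sum_range_succ, Finset.sum_range_succ, ih]
    ring

/-- The weight `ω_{m+i}`, extended by zero beyond the last coordinate. -/
def tailWeight {m n : ℕ} (ω : Fin (m + n) → ℝ) (i : ℕ) : ℝ :=
  if h : i < n then ω (Fin.natAdd m ⟨i, h⟩) else 0

lemma tailWeight_succ_le {m n : ℕ} {ω : Fin (m + n) → ℝ} (hω : IsWeightVector m n ω) (i : ℕ) :
    tailWeight ω (i + 1) ≤ tailWeight ω i := by
  unfold tailWeight
  split_ifs with h₁ h₂ h₂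
  · exact hω.2.2.1 _ _ (by simp) (by simp [Fin.le_def])
  · omega
  · exact (hω.1 _).le
  · exact le_rfl

lemma psiF_eq_sum {m n : ℕ} (ω : Fin (m + n) → ℝ) (V : Submodule ℝ (Fin (m + n) → ℝ))
    (hV : V ⊓ Espan (m + n) m = ⊥) :
    psiF m ω V = ∑ i ∈ Finset.range n, (tailWeight ω i - tailWeight ω (i + 1)) *
      (finrank ℝ ↥(V ⊓ Espan (m + n) (m + i + 1)) : ℝ) := by
  have hn : tailWeight ω n = 0 := by simp [tailWeight]
  have h₀ : finrank ℝ ↥(V ⊓ Espan (m + n) (m + 0)) = 0 := by rw [add_zero, hV, finrank_bot]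
  have h : ∑ i ∈ Finset.range n, tailWeight ω i *
      ((finrank ℝ ↥(V ⊓ Espan (m + n) (m + i + 1)) : ℝ) -
        finrank ℝ ↥(V ⊓ Espan (m + n) (m + i))) =
      ∑ i ∈ Finset.range n, (tailWeight ω i - tailWeight ω (i + 1)) *
        (finrank ℝ ↥(V ⊓ Espan (m + n) (m + i + 1)) : ℝ) := by
    refine (sum_range_mul_sub_eq (tailWeight ω)
      (fun i => (finrank ℝ ↥(V ⊓ Espan (m + n) (m + i)) : ℝ)) n).trans ?_
    simp only [hn, h₀, Nat.cast_zero, mul_zero, zero_mul, sub_zero, add_zero]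
    rfl
  rw [← h, Finset.sum_range, psiF, Iset, Finset.sum_filter, Fin.sum_univ_add,
    Finset.sum_eq_zero (fun i _ => if_neg (by simp)), zero_add]
  refine Finset.sum_congr rfl fun i _ => ?_
  have h₁ := finrank_inf_Espan_succ_le V (Fin.natAdd m i)
  have h₂ := finrank_inf_Espan_mono V (Nat.le_succ (m + i))
  simp only [Fin.val_natAdd, Nat.succ_eq_add_one] at h₁ h₂ ⊢
  have hw : tailWeight ω i = ω (Fin.natAdd m i) := by simp [tailWeight]
  rw [hw]
  split_ifs with hi
  · rw [show finrank ℝ ↥(V ⊓ Espan (m + n) (m + i + 1)) =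
      finrank ℝ ↥(V ⊓ Espan (m + n) (m + i)) + 1 by omega]
    simp
  · rw [show finrank ℝ ↥(V ⊓ Espan (m + n) (m + i + 1)) =
      finrank ℝ ↥(V ⊓ Espan (m + n) (m + i)) by omega]
    simp

theorem psi_set_isZariskiClosed
    (m n : ℕ) (hm : 0 < m) (hn : 0 < n) (hd : 2 ≤ m + n)
    (ω : Fin (m + n) → ℝ) (hω : IsWeightVector m n ω)
    (a : ℝ) (k : ℕ) (hk1 : 1 ≤ k) (hk2 : k ≤ m + n - 1)
    (W : Submodule ℝ (Fin (m + n) → ℝ)) (hW : Module.finrank ℝ W = k) :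
    IsZariskiClosed {x : Matrix (Fin m) (Fin n) ℝ |
      a ≤ psiF m ω (kerXtil m n x ⊓ W)} := by
  let δ (x : Matrix (Fin m) (Fin n) ℝ) (i : ℕ) : ℕ :=
    finrank ℝ ↥(kerXtil m n x ⊓ (W ⊓ Espan (m + n) (m + i + 1)))
  let F (c : Fin n → ℕ) : ℝ := ∑ i : Fin n, (tailWeight ω i - tailWeight ω (i + 1)) * (c i : ℝ)
  have hψ (x : Matrix (Fin m) (Fin n) ℝ) :
      psiF m ω (kerXtil m n x ⊓ W) = F fun i => δ x i := by
    rw [psiF_eq_sum, Finset.sum_range]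
    · exact Finset.sum_congr rfl fun i _ => by simp only [δ]; rw [inf_assoc]
    · rw [inf_right_comm, kerXtil_inf_Espan, bot_inf_eq]
  have hF : Monotone F := fun c c' h => Finset.sum_le_sum fun i _ =>
    mul_le_mul_of_nonneg_left (Nat.cast_le.2 (h i)) (sub_nonneg.2 (tailWeight_succ_le hω i))
  have hset : {x : Matrix (Fin m) (Fin n) ℝ | a ≤ psiF m ω (kerXtil m n x ⊓ W)} =
      ⋃ c ∈ {c : Fin n → ℕ | c ≤ (fun _ => m + n) ∧ a ≤ F c}, ⋂ i, {x | c i ≤ δ x i} := by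
    ext x
    simp only [Set.mem_ofPred_eq, Set.mem_iUnion, Set.mem_iInter, hψ]
    refine ⟨fun h => ⟨_, ⟨fun i => ?_, h⟩, fun i => le_rfl⟩, fun ⟨c, ⟨_, hc⟩, h⟩ => hc.trans (hF h)⟩
    exact (Submodule.finrank_le _).trans (by simp)
  rw [hset]
  refine .biUnion ((Set.finite_Iic _).subset fun c hc => hc.1) fun c _ => .iInter fun i => ?_
  exact isZariskiClosed_le_finrank_kerXtil_inf _ _

end
end

section
/- Let d = m + n ≥ 2, let ω be an (m,n)-weight vector, let b ∈ ℝ, and let W ⊂ ℝ^d be a k-dimensional linear subspace for some k ∈ {1,…,d−1}. Then the set {x ∈ M_{m,n}(ℝ) : φ(x̃W) ≤ b} is Zariski closed in M_{m,n}(ℝ). -/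
open scoped Classical
open MeasureTheory Module Matrix

noncomputable section

/-- Abel summation: an antitone nonnegative weight paired with a function whose partial sums
are nonnegative gives a nonnegative sum. -/
theorem sum_range_mul_nonneg_of_antitone {f g : ℕ → ℝ} (hf : Antitone f) (hf0 : ∀ i, 0 ≤ f i)
    (hg : ∀ t, 0 ≤ ∑ i ∈ Finset.range t, g i) (t : ℕ) :
    0 ≤ ∑ i ∈ Finset.range t, f i * g i := by
  have key : f t * ∑ i ∈ Finset.range t, g i ≤ ∑ i ∈ Finset.range t, f i * g i := by
    induction t with
    | zero => simp
    | succ t ih =>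
      calc f (t + 1) * ∑ i ∈ Finset.range (t + 1), g i
          ≤ f t * ∑ i ∈ Finset.range (t + 1), g i :=
            mul_le_mul_of_nonneg_right (hf t.le_succ) (hg _)
        _ ≤ ∑ i ∈ Finset.range (t + 1), f i * g i := by
            rw [Finset.sum_range_succ, Finset.sum_range_succ, mul_add]
            linarith
  exact (mul_nonneg (hf0 t) (hg t)).trans key

/-- Rank-nullity for the restriction of a linear map to a subspace. -/
theorem finrank_map_add_finrank_inf_ker {K V U : Type*} [Field K] [AddCommGroup V] [Module K V]
    [FiniteDimensional K V] [AddCommGroup U] [Module K U] (f : V →ₗ[K] U) (A : Submodule K V) :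
    finrank K (A.map f) + finrank K ↥(A ⊓ LinearMap.ker f) = finrank K A := by
  have h := LinearMap.finrank_range_add_finrank_ker (f.domRestrict A)
  have h1 : LinearMap.range (f.domRestrict A) = A.map f := by
    rw [LinearMap.domRestrict, LinearMap.range_comp, Submodule.range_subtype]
  have h2 : (LinearMap.ker (f.domRestrict A)).map A.subtype = A ⊓ LinearMap.ker f := by
    rw [LinearMap.domRestrict, LinearMap.ker_comp, Submodule.map_comap_subtype]
  rwa [← h1, ← h2,
    ← (Submodule.equivMapOfInjective A.subtype A.injective_subtype _).finrank_eq]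

theorem mem_Eprime {m j : ℕ} {v : Fin m → ℝ} :
    v ∈ Eprime m j ↔ ∀ i : Fin m, (i : ℕ) < j → v i = 0 := by
  constructor
  · intro hv i hi
    have hle : Eprime m j ≤
        LinearMap.ker (LinearMap.proj (R := ℝ) (φ := fun _ : Fin m => ℝ) i) := by
      refine Submodule.span_le.2 ?_
      rintro _ ⟨l, hl, rfl⟩
      have hne : i ≠ l := by rintro rfl; omega
      simp [hne]
    simpa using hle hv
  · intro hv
    rw [← Finset.univ_sum_single v]
    refine Submodule.sum_mem _ fun i _ => ?_
    by_cases hi : (i : ℕ) < j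
    · simp [hv i hi]
    · have : (Pi.single i (v i) : Fin m → ℝ) = v i • Pi.single i (1 : ℝ) := by
        rw [← Pi.single_smul]; simp
      rw [this]
      exact Submodule.smul_mem _ _ (Submodule.subset_span ⟨i, not_lt.1 hi, rfl⟩)

theorem Eprime_antitone (m : ℕ) : Antitone (Eprime m) := fun _ _ h _ hv =>
  mem_Eprime.2 fun i hi => mem_Eprime.1 hv i (hi.trans_le h)

theorem Eprime_zero (m : ℕ) : Eprime m 0 = ⊤ :=
  eq_top_iff.2 fun _ _ => mem_Eprime.2 fun _ h => absurd h (Nat.not_lt_zero _)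

theorem Eprime_self (m : ℕ) : Eprime m m = ⊥ :=
  eq_bot_iff.2 fun _ hv => (Submodule.mem_bot ℝ).2 <| funext fun i => mem_Eprime.1 hv i i.2

theorem finrank_inf_Eprime_le_succ {m : ℕ} (A : Submodule ℝ (Fin m → ℝ)) (j : Fin m) :
    finrank ℝ ↥(A ⊓ Eprime m j) ≤ finrank ℝ ↥(A ⊓ Eprime m (j + 1)) + 1 := by
  let p : (Fin m → ℝ) →ₗ[ℝ] ℝ := LinearMap.proj j
  have h := finrank_map_add_finrank_inf_ker p (A ⊓ Eprime m j)
  have hk : A ⊓ Eprime m j ⊓ LinearMap.ker p ≤ A ⊓ Eprime m (j + 1) := by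
    rintro v ⟨⟨hA, hE⟩, hv⟩
    refine ⟨hA, mem_Eprime.2 fun i hi => ?_⟩
    rcases (Nat.lt_succ_iff.1 hi).lt_or_eq with hlt | heq
    · exact mem_Eprime.1 hE i hlt
    · rw [Fin.ext heq]; exact hv
  have h1 : finrank ℝ ↥((A ⊓ Eprime m j).map p) ≤ 1 := by
    simpa using Submodule.finrank_le ((A ⊓ Eprime m j).map p)
  have h2 := Submodule.finrank_mono hk
  omega

/-- The drop of `dim (A ∩ ⟨e_j, …, e_m⟩)` at `j` is the indicator of `Jset A`. -/
theorem finrank_inf_Eprime_sub_succ {m : ℕ} (A : Submodule ℝ (Fin m → ℝ)) (j : Fin m) :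
    (finrank ℝ ↥(A ⊓ Eprime m j) : ℝ) - finrank ℝ ↥(A ⊓ Eprime m (j + 1)) =
      if j ∈ Jset A then 1 else 0 := by
  have h1 := finrank_inf_Eprime_le_succ A j
  have h2 : finrank ℝ ↥(A ⊓ Eprime m (j + 1)) ≤ finrank ℝ ↥(A ⊓ Eprime m j) :=
    Submodule.finrank_mono (inf_le_inf_left A (Eprime_antitone m (Nat.le_succ _)))
  split_ifs with hj
  · have hlt : finrank ℝ ↥(A ⊓ Eprime m (j + 1)) < finrank ℝ ↥(A ⊓ Eprime m j) := by
      simpa [Jset] using hj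
    have : finrank ℝ ↥(A ⊓ Eprime m j) = finrank ℝ ↥(A ⊓ Eprime m (j + 1)) + 1 := by omega
    rw [this]; push_cast; ring
  · have hge : ¬ finrank ℝ ↥(A ⊓ Eprime m (j + 1)) < finrank ℝ ↥(A ⊓ Eprime m j) := by
      simpa [Jset] using hj
    have : finrank ℝ ↥(A ⊓ Eprime m j) = finrank ℝ ↥(A ⊓ Eprime m (j + 1)) := by omega
    rw [this, sub_self]

theorem card_Jset {m : ℕ} (A : Submodule ℝ (Fin m → ℝ)) : (Jset A).card = finrank ℝ A := by
  have h : ((Jset A).card : ℝ) = ∑ j : Fin m, if j ∈ Jset A then (1 : ℝ) else 0 := by simp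
  simp_rw [← finrank_inf_Eprime_sub_succ] at h
  rw [Fin.sum_univ_eq_sum_range (fun j => (finrank ℝ ↥(A ⊓ Eprime m j) : ℝ) -
    finrank ℝ ↥(A ⊓ Eprime m (j + 1))), Finset.sum_range_sub', Eprime_zero, Eprime_self,
    inf_top_eq, inf_bot_eq, finrank_bot, Nat.cast_zero, sub_zero] at h
  exact_mod_cast h

/-- The restriction of vectors to the coordinates in `I`. -/
def restrictCoords {m : ℕ} (I : Finset (Fin m)) : (Fin m → ℝ) →ₗ[ℝ] (I → ℝ) :=
  LinearMap.funLeft ℝ ℝ Subtype.val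

@[simp]
theorem restrictCoords_apply {m : ℕ} (I : Finset (Fin m)) (v : Fin m → ℝ) (i : I) :
    restrictCoords I v i = v i := rfl

theorem map_restrictCoords_Jset {m : ℕ} (A : Submodule ℝ (Fin m → ℝ)) :
    A.map (restrictCoords (Jset A)) = ⊤ := by
  have hker : A ⊓ LinearMap.ker (restrictCoords (Jset A)) = ⊥ := by
    refine eq_bot_iff.2 ?_
    rintro v ⟨hA, hv⟩
    have hv0 : ∀ t ≤ m, v ∈ Eprime m t := by
      intro t
      induction t with
      | zero => simp [Eprime_zero]
      | succ t ih =>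
        intro ht
        have hvt := ih (Nat.le_of_succ_le ht)
        by_cases hj : (⟨t, ht⟩ : Fin m) ∈ Jset A
        · refine mem_Eprime.2 fun i hi => ?_
          rcases (Nat.lt_succ_iff.1 hi).lt_or_eq with hlt | heq
          · exact mem_Eprime.1 hvt i hlt
          · rw [show i = ⟨t, ht⟩ from Fin.ext heq]
            exact congrFun (LinearMap.mem_ker.1 hv) ⟨_, hj⟩
        · have hd := finrank_inf_Eprime_sub_succ A ⟨t, ht⟩
          rw [if_neg hj, sub_eq_zero, Nat.cast_inj] at hd
          have heq := Submodule.eq_of_le_of_finrank_eq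
            (inf_le_inf_left A (Eprime_antitone m (Nat.le_succ t))) hd.symm
          exact (heq ▸ (⟨hA, hvt⟩ : v ∈ A ⊓ Eprime m t) : v ∈ A ⊓ Eprime m (t + 1)).2
    simpa [Eprime_self] using hv0 m le_rfl
  refine Submodule.eq_top_of_finrank_eq ?_
  have h := finrank_map_add_finrank_inf_ker (restrictCoords (Jset A)) A
  rw [hker, finrank_bot, add_zero, ← card_Jset] at h
  simpa using h

theorem card_filter_add_finrank_inf_Eprime_le {m : ℕ} {A : Submodule ℝ (Fin m → ℝ)}
    {I : Finset (Fin m)} (hI : A.map (restrictCoords I) = ⊤) (t : ℕ) :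
    (I.filter fun i : Fin m => (i : ℕ) < t).card + finrank ℝ ↥(A ⊓ Eprime m t) ≤
      finrank ℝ A := by
  set S := I.filter fun i : Fin m => (i : ℕ) < t with hS
  have hsub : S ⊆ I := Finset.filter_subset _ _
  have htop : A.map (restrictCoords S) = ⊤ := by
    refine eq_top_iff.2 fun y _ => ?_
    obtain ⟨v, hv, hvy⟩ : (fun i : I => if h : (i : Fin m) ∈ S then y ⟨i, h⟩ else 0) ∈
        A.map (restrictCoords I) := hI ▸ Submodule.mem_top
    refine ⟨v, hv, funext fun i => ?_⟩
    simpa using congrFun hvy ⟨i, hsub i.2⟩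
  have h := finrank_map_add_finrank_inf_ker (restrictCoords S) A
  rw [htop, finrank_top, finrank_fintype_fun_eq_card, Fintype.card_coe] at h
  have hle : A ⊓ Eprime m t ≤ A ⊓ LinearMap.ker (restrictCoords S) :=
    inf_le_inf_left A fun v hv => LinearMap.mem_ker.2 <| funext fun i =>
      mem_Eprime.1 hv i (Finset.mem_filter.1 i.2).2
  have := Submodule.finrank_mono hle
  omega

theorem sum_le_phiF {m n : ℕ} {ω : Fin (m + n) → ℝ} (hω : IsWeightVector m n ω)
    {A : Submodule ℝ (Fin m → ℝ)} {I : Finset (Fin m)} (hI : A.map (restrictCoords I) = ⊤) :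
    ∑ i ∈ I, ω (Fin.castAdd n i) ≤ phiF m n ω A := by
  let f : ℕ → ℝ := fun t => if h : t < m then ω (Fin.castAdd n ⟨t, h⟩) else 0
  have hf0 : ∀ t, 0 ≤ f t := fun t => by
    by_cases h : t < m
    · simpa [f, h] using (hω.1 _).le
    · simp [f, h]
  have hf : Antitone f := fun s t hst => by
    by_cases h : t < m
    · simpa [f, h, hst.trans_lt h] using
        hω.2.1 _ _ (by simpa [Fin.le_def] using hst) (by simpa using h)
    · simpa [f, h] using hf0 s
  let D : ℕ → ℝ := fun t => finrank ℝ ↥(A ⊓ Eprime m t)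
  let g : ℕ → ℝ := fun t => (D t - D (t + 1)) - if t ∈ I.map Fin.valEmbedding then 1 else 0
  have hg : ∀ t, 0 ≤ ∑ i ∈ Finset.range t, g i := fun t => by
    have h := card_filter_add_finrank_inf_Eprime_le hI t
    have hc : ((Finset.range t).filter fun i => i ∈ I.map Fin.valEmbedding).card =
        (I.filter fun i : Fin m => (i : ℕ) < t).card := by
      rw [← Finset.card_map (s := I.filter _) Fin.valEmbedding]
      congr 1
      ext i
      simp only [Finset.mem_filter, Finset.mem_range, Finset.mem_map, Fin.valEmbedding_apply]
      constructor
      · rintro ⟨h1, a, ha, rfl⟩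
        exact ⟨a, ⟨ha, h1⟩, rfl⟩
      · rintro ⟨a, ⟨ha, h1⟩, rfl⟩
        exact ⟨h1, a, ha, rfl⟩
    rw [Finset.sum_sub_distrib, Finset.sum_range_sub', Finset.sum_boole, hc]
    have hD : D 0 = finrank ℝ A := by simp only [D]; rw [Eprime_zero, inf_top_eq]
    rw [hD, sub_nonneg, le_sub_iff_add_le]
    simp only [D]
    exact_mod_cast h
  have hmain := sum_range_mul_nonneg_of_antitone hf hf0 hg m
  rw [← Fin.sum_univ_eq_sum_range (fun i => f i * g i)] at hmain
  have hterm : ∀ i : Fin m, f i * g i =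
      (if i ∈ Jset A then ω (Fin.castAdd n i) else 0) -
        if i ∈ I then ω (Fin.castAdd n i) else 0 := fun i => by
    have h1 : D i - D (i + 1) = if i ∈ Jset A then 1 else 0 := finrank_inf_Eprime_sub_succ A i
    have h2 : (i : ℕ) ∈ I.map Fin.valEmbedding ↔ i ∈ I := by simp [Fin.val_inj]
    simp only [f, g, h1, h2, i.2, dite_true, Fin.eta, mul_sub, mul_ite, mul_one, mul_zero]
  simp_rw [hterm] at hmain
  rw [Finset.sum_sub_distrib, Finset.sum_ite_mem, Finset.sum_ite_mem] at hmain
  simpa [phiF] using hmain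

/-- `φ(A)` is the largest weight of a set of coordinates that are independent on `A`. -/
theorem phiF_le_iff {m n : ℕ} {ω : Fin (m + n) → ℝ} (hω : IsWeightVector m n ω)
    (A : Submodule ℝ (Fin m → ℝ)) (b : ℝ) :
    phiF m n ω A ≤ b ↔ ∀ I : Finset (Fin m), b < ∑ i ∈ I, ω (Fin.castAdd n i) →
      A.map (restrictCoords I) ≠ ⊤ := by
  constructor
  · intro h I hb hI
    exact (hb.trans_le ((sum_le_phiF hω hI).trans h)).false
  · intro h
    by_contra! hb
    exact h _ hb (map_restrictCoords_Jset A)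

/-- A subspace of `ι → ℝ` is everything iff some family of its members has nonzero
determinant. -/
theorem Submodule.eq_top_iff_exists_det_ne_zero {K ι : Type*} [Field K] [Fintype ι]
    [DecidableEq ι] (B : Submodule K (ι → K)) :
    B = ⊤ ↔ ∃ w : ι → ι → K, (∀ i, w i ∈ B) ∧ (Matrix.of w).det ≠ 0 := by
  constructor
  · rintro rfl
    exact ⟨(1 : Matrix ι ι K), fun _ => Submodule.mem_top, by
      rw [show Matrix.of (1 : Matrix ι ι K) = 1 from rfl]; simp⟩
  · rintro ⟨w, hw, hdet⟩
    have hli : LinearIndependent K w :=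
      Matrix.linearIndependent_rows_of_det_ne_zero hdet
    rw [eq_top_iff, ← hli.span_eq_top_of_card_eq_finrank' (by simp)]
    exact Submodule.span_le.2 (Set.range_subset_iff.2 hw)

/-- The entries of `x̃` as polynomials in the entries of `x`. -/
def xTilPoly (m n : ℕ) (i : Fin m) (j : Fin (m + n)) : MvPolynomial (Fin m × Fin n) ℝ :=
  Fin.addCases (fun l => if i = l then 1 else 0) (fun l => MvPolynomial.X (i, l)) j

theorem eval_xTilPoly {m n : ℕ} (x : Matrix (Fin m) (Fin n) ℝ) (i : Fin m) (j : Fin (m + n)) :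
    MvPolynomial.eval (fun ij => x ij.1 ij.2) (xTilPoly m n i j) = xTil m n x i j := by
  refine Fin.addCases (fun l => ?_) (fun l => ?_) j
  · simp [xTilPoly, xTil, uMat, Matrix.one_apply, apply_ite]
  · simp [xTilPoly, xTil, uMat]

/-- The minor of `(x̃ w₁, …)` with rows in `I`, as a polynomial in the entries of `x`. -/
def minorPoly (m n : ℕ) (I : Finset (Fin m)) (w : I → Fin (m + n) → ℝ) :
    MvPolynomial (Fin m × Fin n) ℝ :=
  Matrix.det (Matrix.of fun c r : I => ∑ l, xTilPoly m n r l * MvPolynomial.C (w c l))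

theorem eval_minorPoly {m n : ℕ} (x : Matrix (Fin m) (Fin n) ℝ) (I : Finset (Fin m))
    (w : I → Fin (m + n) → ℝ) :
    MvPolynomial.eval (fun ij => x ij.1 ij.2) (minorPoly m n I w) =
      Matrix.det (Matrix.of fun c : I => restrictCoords I ((xTil m n x).mulVecLin (w c))) := by
  rw [minorPoly, RingHom.map_det]
  congr 1
  ext c r
  simp [eval_xTilPoly, Matrix.mulVec, dotProduct]

theorem map_restrictCoords_xTil_eq_top_iff {m n : ℕ} (W : Submodule ℝ (Fin (m + n) → ℝ))
    (x : Matrix (Fin m) (Fin n) ℝ) (I : Finset (Fin m)) :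
    (W.map (xTil m n x).mulVecLin).map (restrictCoords I) = ⊤ ↔
      ∃ w : I → Fin (m + n) → ℝ, (∀ c, w c ∈ W) ∧
        MvPolynomial.eval (fun ij => x ij.1 ij.2) (minorPoly m n I w) ≠ 0 := by
  rw [Submodule.eq_top_iff_exists_det_ne_zero]
  constructor
  · rintro ⟨y, hy, hdet⟩
    choose u hu huy using hy
    choose w hw hwu using hu
    refine ⟨w, hw, ?_⟩
    rw [eval_minorPoly]
    simpa only [hwu, huy] using hdet
  · rintro ⟨w, hw, hdet⟩
    rw [eval_minorPoly] at hdet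
    exact ⟨_, fun c => Submodule.mem_map_of_mem (Submodule.mem_map_of_mem (hw c)), hdet⟩

theorem phi_set_isZariskiClosed
    (m n : ℕ) (hm : 0 < m) (hn : 0 < n) (hd : 2 ≤ m + n)
    (ω : Fin (m + n) → ℝ) (hω : IsWeightVector m n ω)
    (b : ℝ) (k : ℕ) (hk1 : 1 ≤ k) (hk2 : k ≤ m + n - 1)
    (W : Submodule ℝ (Fin (m + n) → ℝ)) (hW : Module.finrank ℝ W = k) :
    IsZariskiClosed {x : Matrix (Fin m) (Fin n) ℝ |
      phiF m n ω (W.map (xTil m n x).mulVecLin) ≤ b} := by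
  refine ⟨{p | ∃ I : Finset (Fin m), b < ∑ i ∈ I, ω (Fin.castAdd n i) ∧
    ∃ w : I → Fin (m + n) → ℝ, (∀ c, w c ∈ W) ∧ minorPoly m n I w = p}, Set.ext fun x => ?_⟩
  simp only [Set.mem_ofPred_eq, phiF_le_iff hω, ne_eq, map_restrictCoords_xTil_eq_top_iff]
  constructor
  · rintro h _ ⟨I, hb, w, hw, rfl⟩
    by_contra hne
    exact h I hb ⟨w, hw, hne⟩
  · rintro h I hb ⟨w, hw, hne⟩
    exact hne (h _ ⟨I, hb, w, hw, rfl⟩)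

end
end

section
/- Let d ≥ 2, let ω be a (d−1,1)-weight vector, let x = ᵗ(ξ_1,…,ξ_{d−1}) ∈ M_{d−1,1}(ℝ), and let k ∈ {1,…,d−1}. Assume there exist n_1,…,n_k ∈ {1,…,d−1} such that 1, ξ_{n_1},…,ξ_{n_k} are linearly independent over ℚ. Then {x} is not contained in any proper rational weakly constraining k-pencil, and L^ω(Λ_x,·) is connected at k. In particular, if 1, ξ_1,…,ξ_{d−1} are linearly independent over ℚ, then L^ω(Λ_x,·) is connected at every k ∈ {1,…,d−1}. -/
open scoped Classical
open MeasureTheory Module Matrix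

noncomputable section

/-- The `i`-th successive minimum, at time `t`, of a family of gauges `N t` along a set `S`. -/
def gaugeMin {V : Type*} [AddCommGroup V] [Module ℝ V] (S : Set V) (N : ℝ → V → ℝ)
    (i : ℕ) (t : ℝ) : ℝ :=
  sInf {r : ℝ | 0 < r ∧ ∃ v : Fin i → V,
    (∀ j, v j ∈ S) ∧ LinearIndependent ℝ v ∧ ∀ j, N t (v j) ≤ r}

/-- The span of the vectors of `S` that are shorter than the `i`-th minimum at time `t`. -/
def shortSpan {V : Type*} [AddCommGroup V] [Module ℝ V] (S : Set V) (N : ℝ → V → ℝ)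
    (i : ℕ) (t : ℝ) : Submodule ℝ V :=
  Submodule.span ℝ {w | w ∈ S ∧ N t w < gaugeMin S N i t}

section GaugeMin

variable {V : Type*} [AddCommGroup V] [Module ℝ V] {S : Set V} {N : ℝ → V → ℝ}

lemma gaugeMin_le {i : ℕ} {t r : ℝ} (hr : 0 < r) (v : Fin i → V) (hS : ∀ j, v j ∈ S)
    (hv : LinearIndependent ℝ v) (hN : ∀ j, N t (v j) ≤ r) : gaugeMin S N i t ≤ r :=
  csInf_le ⟨0, fun _ h => h.1.le⟩ ⟨hr, v, hS, hv, hN⟩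

lemma gaugeMin_set_nonempty {i : ℕ} (hex : ∃ v : Fin i → V, (∀ j, v j ∈ S) ∧ LinearIndependent ℝ v)
    (t : ℝ) : {r : ℝ | 0 < r ∧ ∃ v : Fin i → V,
      (∀ j, v j ∈ S) ∧ LinearIndependent ℝ v ∧ ∀ j, N t (v j) ≤ r}.Nonempty := by
  obtain ⟨v, hS, hv⟩ := hex
  obtain ⟨M, hM⟩ := (Set.finite_range fun j => N t (v j)).bddAbove
  exact ⟨max M 1, by positivity, v, hS, hv, fun j => le_max_of_le_left (hM ⟨j, rfl⟩)⟩

lemma exists_of_gaugeMin_lt {i : ℕ}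
    (hex : ∃ v : Fin i → V, (∀ j, v j ∈ S) ∧ LinearIndependent ℝ v) {t r : ℝ}
    (h : gaugeMin S N i t < r) :
    ∃ v : Fin i → V, (∀ j, v j ∈ S) ∧ LinearIndependent ℝ v ∧ ∀ j, N t (v j) < r := by
  obtain ⟨r', ⟨-, v, hS, hv, hN⟩, hr'⟩ := exists_lt_of_csInf_lt (gaugeMin_set_nonempty hex t) h
  exact ⟨v, hS, hv, fun j => (hN j).trans_lt hr'⟩

lemma gaugeMin_le_succ {k : ℕ}
    (hex : ∃ v : Fin (k + 1) → V, (∀ j, v j ∈ S) ∧ LinearIndependent ℝ v) (t : ℝ) :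
    gaugeMin S N k t ≤ gaugeMin S N (k + 1) t := by
  refine le_csInf (gaugeMin_set_nonempty hex t) ?_
  rintro r ⟨hr, v, hS, hv, hN⟩
  exact gaugeMin_le hr (v ∘ Fin.castSucc) (fun j => hS _)
    (hv.comp _ (Fin.castSucc_injective k)) (fun j => hN _)

lemma gaugeMin_le_exp_mul {i : ℕ}
    (hex : ∃ v : Fin i → V, (∀ j, v j ∈ S) ∧ LinearIndependent ℝ v)
    (hN : ∀ s t w, N s w ≤ Real.exp |s - t| * N t w) (s t : ℝ) :
    gaugeMin S N i s ≤ Real.exp |s - t| * gaugeMin S N i t := by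
  have hpos := Real.exp_pos |s - t|
  rw [← div_le_iff₀' hpos]
  refine le_csInf (gaugeMin_set_nonempty hex t) ?_
  rintro r ⟨hr, v, hS, hv, hNv⟩
  rw [div_le_iff₀' hpos]
  exact gaugeMin_le (by positivity) v hS hv fun j =>
    (hN s t _).trans (mul_le_mul_of_nonneg_left (hNv j) hpos.le)

variable [FiniteDimensional ℝ V]

lemma finrank_shortSpan_le (hN0 : ∀ t w, 0 ≤ N t w) (k : ℕ) (t : ℝ) :
    finrank ℝ (shortSpan S N (k + 1) t) ≤ k := by
  by_contra! hlt
  obtain ⟨f, hf, -, hli⟩ := Submodule.exists_fun_fin_finrank_span_eq ℝ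
    {w | w ∈ S ∧ N t w < gaugeMin S N (k + 1) t}
  let g : Fin (k + 1) → V := f ∘ Fin.castLE hlt
  have hg : ∀ j, g j ∈ S ∧ N t (g j) < gaugeMin S N (k + 1) t := fun j => hf _
  have hpos : 0 < gaugeMin S N (k + 1) t := (hN0 t _).trans_lt (hg 0).2
  have hsup : Finset.univ.sup' Finset.univ_nonempty (fun j => N t (g j)) <
      gaugeMin S N (k + 1) t := (Finset.sup'_lt_iff _).2 fun j _ => (hg j).2
  refine (max_lt hsup (half_lt_self hpos)).not_ge (gaugeMin_le (lt_max_of_lt_right (half_pos hpos))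
    g (fun j => (hg j).1) (hli.comp _ (Fin.castLE_injective hlt)) fun j => le_max_of_le_left ?_)
  exact Finset.le_sup' (fun j => N t (g j)) (Finset.mem_univ j)

lemma span_range_eq_shortSpan (hN0 : ∀ t w, 0 ≤ N t w) {k : ℕ} {t : ℝ} (v : Fin k → V)
    (hS : ∀ j, v j ∈ S) (hv : LinearIndependent ℝ v)
    (hlt : ∀ j, N t (v j) < gaugeMin S N (k + 1) t) :
    Submodule.span ℝ (Set.range v) = shortSpan S N (k + 1) t := by
  refine Submodule.eq_of_le_of_finrank_le (Submodule.span_mono ?_) ?_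
  · rintro _ ⟨j, rfl⟩
    exact ⟨hS j, hlt j⟩
  · rw [finrank_span_eq_card hv, Fintype.card_fin]
    exact finrank_shortSpan_le hN0 k t

/-- If the `k`-th and `(k+1)`-st minima differ from time `T` on, then the span of the vectors
shorter than the `(k+1)`-st minimum does not depend on the time. -/
lemma shortSpan_eq_of_gaugeMin_ne (hN0 : ∀ t w, 0 ≤ N t w)
    (hN : ∀ s t w, N s w ≤ Real.exp |s - t| * N t w) {k : ℕ}
    (hex : ∃ v : Fin (k + 1) → V, (∀ j, v j ∈ S) ∧ LinearIndependent ℝ v) {T : ℝ}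
    (hne : ∀ t, T ≤ t → gaugeMin S N k t ≠ gaugeMin S N (k + 1) t) {t : ℝ} (ht : T ≤ t) :
    shortSpan S N (k + 1) t = shortSpan S N (k + 1) T := by
  have hex' : ∃ v : Fin k → V, (∀ j, v j ∈ S) ∧ LinearIndependent ℝ v := by
    obtain ⟨v, hS, hv⟩ := hex
    exact ⟨v ∘ Fin.castSucc, fun j => hS _, hv.comp _ (Fin.castSucc_injective k)⟩
  have hloc : IsLocallyConstant fun s : Set.Ici T => shortSpan S N (k + 1) (s : ℝ) := by
    rw [IsLocallyConstant.iff_eventually_eq]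
    rintro ⟨t, ht⟩
    obtain ⟨r, hr1, hr2⟩ := exists_between ((gaugeMin_le_succ hex t).lt_of_ne (hne t ht))
    obtain ⟨v, hS, hv, hlt⟩ := exists_of_gaugeMin_lt hex' hr1
    have hcont : Continuous fun s : Set.Ici T =>
        Real.exp |(s : ℝ) - t| * (Real.exp |(s : ℝ) - t| * r) := by fun_prop
    have hev := (hcont.tendsto ⟨t, ht⟩).eventually_lt_const
      (u := gaugeMin S N (k + 1) t) (by simpa using hr2)
    filter_upwards [hev] with s hs
    rw [← span_range_eq_shortSpan hN0 v hS hv fun j => (hlt j).trans hr2,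
      ← span_range_eq_shortSpan hN0 v hS hv fun j => ?_]
    have h1 := gaugeMin_le_exp_mul hex hN t s
    rw [abs_sub_comm] at h1
    have hpos := Real.exp_pos |(s : ℝ) - t|
    calc N s (v j) ≤ Real.exp |(s : ℝ) - t| * N t (v j) := hN _ _ _
      _ ≤ Real.exp |(s : ℝ) - t| * r := by gcongr; exact (hlt j).le
      _ < gaugeMin S N (k + 1) s := lt_of_mul_lt_mul_left (hs.trans_le h1) hpos.le
  have : PreconnectedSpace (Set.Ici T) := Subtype.preconnectedSpace isPreconnected_Ici
  exact hloc.apply_eq_of_preconnectedSpace ⟨t, ht⟩ ⟨T, Set.self_mem_Ici⟩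

end GaugeMin

section Lattice

variable {m : ℕ}

lemma det_uMat (n : ℕ) (x : Matrix (Fin m) (Fin n) ℝ) : (uMat m n x).det = 1 := by
  simp [uMat]

lemma sum_signedWeight {n : ℕ} {ω : Fin (m + n) → ℝ} (hω : IsWeightVector m n ω) :
    ∑ i, signedWeight m ω i = 0 := by
  obtain ⟨-, -, -, h1, h2⟩ := hω
  simp only [signedWeight, Finset.sum_ite, Finset.sum_neg_distrib, not_lt, h1, h2]
  norm_num

lemma det_aMat {n : ℕ} {ω : Fin (m + n) → ℝ} (hω : IsWeightVector m n ω) (t : ℝ) :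
    (aMat m ω t).det = 1 := by
  rw [aMat, Matrix.det_diagonal, ← Real.exp_sum, ← Finset.sum_mul, sum_signedWeight hω]
  simp

lemma abs_signedWeight_le_one {n : ℕ} {ω : Fin (m + n) → ℝ} (hω : IsWeightVector m n ω)
    (i : Fin (m + n)) : |signedWeight m ω i| ≤ 1 := by
  obtain ⟨h0, -, -, h1, h2⟩ := hω
  have habs : |signedWeight m ω i| = ω i := by
    unfold signedWeight
    split_ifs <;> simp [abs_of_pos (h0 i)]
  rw [habs]
  rcases lt_or_ge (i : ℕ) m with hi | hi
  · rw [← h1]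
    exact Finset.single_le_sum (f := ω) (fun j _ => (h0 j).le) (by simpa using hi)
  · rw [← h2]
    exact Finset.single_le_sum (f := ω) (fun j _ => (h0 j).le) (by simpa using hi)

/-- The sup norm of the image of `w` under `a_t^ω u(x)`. -/
def flowNorm {n : ℕ} (ω : Fin (m + n) → ℝ) (x : Matrix (Fin m) (Fin n) ℝ) (t : ℝ)
    (w : Fin (m + n) → ℝ) : ℝ :=
  ‖aMat m ω t *ᵥ (uMat m n x *ᵥ w)‖

lemma aMat_mulVec_apply {d : ℕ} (ω : Fin d → ℝ) (t : ℝ) (y : Fin d → ℝ) (i : Fin d) :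
    (aMat m ω t *ᵥ y) i = Real.exp (signedWeight m ω i * t) * y i :=
  Matrix.mulVec_diagonal _ _ _

lemma flowNorm_le_exp_mul {n : ℕ} {ω : Fin (m + n) → ℝ} (hω : IsWeightVector m n ω)
    (x : Matrix (Fin m) (Fin n) ℝ) (s t : ℝ) (w : Fin (m + n) → ℝ) :
    flowNorm ω x s w ≤ Real.exp |s - t| * flowNorm ω x t w := by
  refine (pi_norm_le_iff_of_nonneg (by unfold flowNorm; positivity)).2 fun i => ?_
  refine le_trans ?_ (mul_le_mul_of_nonneg_left (norm_le_pi_norm _ i) (Real.exp_pos _).le)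
  simp only [aMat_mulVec_apply, norm_mul, Real.norm_eq_abs, Real.abs_exp, ← mul_assoc,
    ← Real.exp_add]
  gcongr
  have h : signedWeight m ω i * (s - t) ≤ |s - t| := by
    refine (le_abs_self _).trans ?_
    rw [abs_mul]
    exact mul_le_of_le_one_left (abs_nonneg _) (abs_signedWeight_le_one hω i)
  linarith

/-- `a_t^ω u(x)` as a linear map. -/
def flowLin {n : ℕ} (ω : Fin (m + n) → ℝ) (x : Matrix (Fin m) (Fin n) ℝ) (t : ℝ) :
    (Fin (m + n) → ℝ) →ₗ[ℝ] (Fin (m + n) → ℝ) :=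
  Matrix.toLin' (aMat m ω t * uMat m n x)

lemma flowLin_apply {n : ℕ} (ω : Fin (m + n) → ℝ) (x : Matrix (Fin m) (Fin n) ℝ) (t : ℝ)
    (w : Fin (m + n) → ℝ) : flowLin ω x t w = aMat m ω t *ᵥ (uMat m n x *ᵥ w) := by
  simp [flowLin, Matrix.mulVec_mulVec]

lemma det_flowLin {n : ℕ} {ω : Fin (m + n) → ℝ} (hω : IsWeightVector m n ω)
    (x : Matrix (Fin m) (Fin n) ℝ) (t : ℝ) : LinearMap.det (flowLin ω x t) = 1 := by
  rw [flowLin, LinearMap.det_toLin', Matrix.det_mul, det_aMat hω, det_uMat, one_mul]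

lemma ker_flowLin {n : ℕ} {ω : Fin (m + n) → ℝ} (hω : IsWeightVector m n ω)
    (x : Matrix (Fin m) (Fin n) ℝ) (t : ℝ) : LinearMap.ker (flowLin ω x t) = ⊥ := by
  by_contra h
  exact one_ne_zero ((det_flowLin hω x t).symm.trans
    (LinearMap.det_eq_zero_iff_ker_ne_bot.2 h))

lemma succMin_eq_gaugeMin {n : ℕ} {ω : Fin (m + n) → ℝ} (hω : IsWeightVector m n ω)
    (x : Matrix (Fin m) (Fin n) ℝ) (i : ℕ) (t : ℝ) :
    succMin (m + n) ((aMat m ω t).mulVec '' latticeOf (uMat m n x)) i =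
      gaugeMin (intVectors (m + n)) (flowNorm ω x) i t := by
  unfold succMin gaugeMin
  congr 1
  ext r
  refine and_congr_right fun _ => ⟨?_, ?_⟩
  · rintro ⟨v, hv, hli, hr⟩
    choose y hy hyv using hv
    choose w hw hwy using hy
    have hvw : v = flowLin ω x t ∘ w := by
      funext j
      rw [Function.comp_apply, flowLin_apply, hwy, hyv]
    refine ⟨w, hw, (LinearMap.linearIndependent_iff _ (ker_flowLin hω x t)).1 (hvw ▸ hli),
      fun j => ?_⟩
    rw [flowNorm, hwy, hyv]
    exact hr j
  · rintro ⟨w, hw, hli, hr⟩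
    refine ⟨flowLin ω x t ∘ w, fun j => ?_,
      (LinearMap.linearIndependent_iff _ (ker_flowLin hω x t)).2 hli, fun j => ?_⟩
    · rw [Function.comp_apply, flowLin_apply]
      exact ⟨_, ⟨_, hw j, rfl⟩, rfl⟩
    · rw [Function.comp_apply, flowLin_apply]
      exact hr j

/-- Minkowski's first theorem for the lattice `a_t^ω u(x) ℤ^d`. -/
lemma exists_flowNorm_lt_two {n : ℕ} (hd : 0 < m + n) {ω : Fin (m + n) → ℝ}
    (hω : IsWeightVector m n ω) (x : Matrix (Fin m) (Fin n) ℝ) (t : ℝ) :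
    ∃ w ∈ intVectors (m + n), w ≠ 0 ∧ flowNorm ω x t w < 2 := by
  let b := Pi.basisFun ℝ (Fin (m + n))
  have hcvx : Convex ℝ (flowLin ω x t ⁻¹' Metric.ball 0 2) :=
    (convex_ball 0 2).linear_preimage _
  have hvol : volume (flowLin ω x t ⁻¹' Metric.ball 0 2) = ENNReal.ofReal (4 ^ (m + n)) := by
    rw [Measure.addHaar_preimage_linearMap _ (by simp [det_flowLin hω]), det_flowLin hω,
      Real.volume_pi_ball _ two_pos]
    norm_num
  have hfund : volume (ZSpan.fundamentalDomain b) = 1 := by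
    rw [ZSpan.fundamentalDomain_pi_basisFun, Real.volume_pi_Ico]
    simp
  have : Countable ↥(Submodule.span ℤ (Set.range b)).toAddSubgroup :=
    inferInstanceAs (Countable ↥(Submodule.span ℤ (Set.range b)))
  obtain ⟨⟨w, hw⟩, hw0, hwb⟩ := exists_ne_zero_mem_lattice_of_measure_mul_two_pow_lt_measure
    (ZSpan.isAddFundamentalDomain' b volume) (s := flowLin ω x t ⁻¹' Metric.ball 0 2)
    (by simp) hcvx (by
      rw [hfund, hvol, one_mul, finrank_fin_fun, ENNReal.ofReal_pow (by norm_num)]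
      refine ENNReal.pow_right_strictMono hd.ne' ?_
      norm_num)
  refine ⟨w, ?_, fun h => hw0 (Subtype.ext h), ?_⟩
  · have := (b.mem_span_iff_repr_mem ℤ w).1 hw
    choose z hz using this
    exact ⟨z, funext fun i => by simpa [b] using hz i⟩
  · simpa [flowLin_apply, flowNorm] using hwb

lemma exists_linearIndependent_intVectors {d i : ℕ} (hi : i ≤ d) :
    ∃ v : Fin i → (Fin d → ℝ), (∀ j, v j ∈ intVectors d) ∧ LinearIndependent ℝ v := by
  refine ⟨fun j => Pi.basisFun ℝ (Fin d) (Fin.castLE hi j), fun j => ?_,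
    (Pi.basisFun ℝ (Fin d)).linearIndependent.comp _ (Fin.castLE_injective hi)⟩
  refine ⟨Pi.single (Fin.castLE hi j) 1, funext fun l => ?_⟩
  by_cases h : l = Fin.castLE hi j
  · subst h; simp
  · simp [h]

lemma one_le_norm_of_mem_intVectors {d : ℕ} {w : Fin d → ℝ} (hw : w ∈ intVectors d)
    (h0 : w ≠ 0) : 1 ≤ ‖w‖ := by
  obtain ⟨z, rfl⟩ := hw
  obtain ⟨i, hi⟩ := Function.ne_iff.1 h0
  refine le_trans ?_ (norm_le_pi_norm _ i)
  have hz : z i ≠ 0 := by simpa using hi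
  change (1 : ℝ) ≤ |(z i : ℝ)|
  exact_mod_cast Int.one_le_abs hz

/-- On a subspace meeting `ker x̃` trivially, `a_t^ω u(x)` expands uniformly. -/
lemma exists_exp_mul_norm_le_flowNorm {n : ℕ} {ω : Fin (m + n) → ℝ} (hω : IsWeightVector m n ω)
    (x : Matrix (Fin m) (Fin n) ℝ) {W : Submodule ℝ (Fin (m + n) → ℝ)}
    (hW : kerXtil m n x ⊓ W = ⊥) :
    ∃ c > 0, ∃ δ > 0, ∀ t, 0 ≤ t → ∀ w ∈ W, c * Real.exp (δ * t) * ‖w‖ ≤ flowNorm ω x t w := by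
  obtain ⟨K, hK, hanti⟩ := LinearMap.exists_antilipschitzWith
    ((xTil m n x).mulVecLin.domRestrict W) (by
      rw [LinearMap.ker_eq_bot']
      rintro ⟨w, hw⟩ h
      have : w ∈ kerXtil m n x ⊓ W := ⟨h, hw⟩
      rw [hW] at this
      exact Subtype.ext this)
  obtain ⟨δ, hδ, hδω⟩ : ∃ δ > 0, ∀ i, δ ≤ ω i := by
    cases isEmpty_or_nonempty (Fin (m + n))
    · exact ⟨1, one_pos, fun i => isEmptyElim i⟩
    · obtain ⟨i, hi⟩ := Finite.exists_min ω
      exact ⟨ω i, hω.1 i, hi⟩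
  refine ⟨(K : ℝ)⁻¹, by positivity, δ, hδ, fun t ht w hw => ?_⟩
  have h1 : ‖w‖ ≤ K * ‖xTil m n x *ᵥ w‖ := by
    simpa using hanti.le_mul_norm_sub ⟨w, hw⟩ 0
  have h2 : ‖xTil m n x *ᵥ w‖ ≤ Real.exp (-(δ * t)) * flowNorm ω x t w := by
    refine (pi_norm_le_iff_of_nonneg (by unfold flowNorm; positivity)).2 fun i => ?_
    refine le_trans ?_ (mul_le_mul_of_nonneg_left (norm_le_pi_norm _ (Fin.castAdd n i))
      (Real.exp_pos _).le)
    rw [aMat_mulVec_apply, norm_mul, Real.norm_of_nonneg (Real.exp_pos _).le, ← mul_assoc,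
      ← Real.exp_add]
    refine le_mul_of_one_le_left (norm_nonneg _) (Real.one_le_exp ?_)
    have := mul_le_mul_of_nonneg_right (hδω (Fin.castAdd n i)) ht
    simp only [signedWeight, Fin.val_castAdd, Fin.is_lt, if_true]
    linarith
  have hKpos : (0 : ℝ) < K := by exact_mod_cast hK
  calc (K : ℝ)⁻¹ * Real.exp (δ * t) * ‖w‖
      ≤ (K : ℝ)⁻¹ * Real.exp (δ * t) * (K * (Real.exp (-(δ * t)) * flowNorm ω x t w)) := by
        gcongr
        exact h1.trans (by gcongr)
    _ = flowNorm ω x t w := by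
        rw [Real.exp_neg]
        field_simp

/-- If `ker x̃` meets no rational subspace of dimension at most `k`, then `L^ω(Λ_x, ·)` is
connected at `k`. -/
lemma connectedAt_of_disjoint {n : ℕ} {ω : Fin (m + n) → ℝ} (hω : IsWeightVector m n ω)
    (x : Matrix (Fin m) (Fin n) ℝ) {k : ℕ} (hk1 : 1 ≤ k) (hk2 : k < m + n)
    (hx : ∀ W : Submodule ℝ (Fin (m + n) → ℝ), IsRationalSubspace W → finrank ℝ W ≤ k →
      kerXtil m n x ⊓ W = ⊥) :
    ConnectedAt m ω (latticeOf (uMat m n x)) k := by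
  by_contra hcon
  unfold ConnectedAt at hcon
  push Not at hcon
  obtain ⟨T, hT⟩ := hcon
  let S := intVectors (m + n)
  let N := flowNorm ω x
  have hex : ∃ v : Fin (k + 1) → (Fin (m + n) → ℝ), (∀ j, v j ∈ S) ∧ LinearIndependent ℝ v :=
    exists_linearIndependent_intVectors hk2
  have hex' : ∃ v : Fin k → (Fin (m + n) → ℝ), (∀ j, v j ∈ S) ∧ LinearIndependent ℝ v :=
    exists_linearIndependent_intVectors hk2.le
  have hN0 : ∀ t w, 0 ≤ N t w := fun t w => norm_nonneg _
  have hne : ∀ t, max T 0 ≤ t → gaugeMin S N k t ≠ gaugeMin S N (k + 1) t := by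
    intro t ht h
    refine hT t ((le_max_right _ _).trans ht) ((le_max_left _ _).trans ht) ?_
    rw [Lfun, Lfun, succMin_eq_gaugeMin hω, succMin_eq_gaugeMin hω]
    exact congrArg Real.log h
  let W := shortSpan S N (k + 1) (max T 0)
  have hWt : ∀ t, max T 0 ≤ t → shortSpan S N (k + 1) t = W := fun t ht =>
    shortSpan_eq_of_gaugeMin_ne hN0 (flowNorm_le_exp_mul hω x) hex hne ht
  have hrat : IsRationalSubspace W := by
    refine ⟨{q | (fun i => (q i : ℝ)) ∈ {w | w ∈ S ∧ N (max T 0) w <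
      gaugeMin S N (k + 1) (max T 0)}}, ?_⟩
    refine congrArg (Submodule.span ℝ) (Set.Subset.antisymm ?_ ?_)
    · rintro _ ⟨q, hq, rfl⟩
      exact hq
    · rintro w ⟨⟨z, rfl⟩, hw⟩
      exact ⟨fun i => z i, by simpa using ⟨⟨z, rfl⟩, hw⟩, by simp⟩
  obtain ⟨c, hc, δ, hδ, hexp⟩ := exists_exp_mul_norm_le_flowNorm hω x
    (hx W hrat (finrank_shortSpan_le hN0 k _))
  have hshort : ∀ t, max T 0 ≤ t → ∃ w ∈ S, w ∈ W ∧ w ≠ 0 ∧ N t w < 2 := by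
    intro t ht
    obtain ⟨w, hwS, hw0, hw2⟩ := exists_flowNorm_lt_two (by omega) hω x t
    rcases lt_or_ge (N t w) (gaugeMin S N (k + 1) t) with h | h
    · exact ⟨w, hwS, hWt t ht ▸ Submodule.subset_span ⟨hwS, h⟩, hw0, hw2⟩
    · obtain ⟨v, hvS, hv, hlt⟩ := exists_of_gaugeMin_lt hex'
        ((gaugeMin_le_succ hex t).lt_of_ne (hne t ht))
      let j : Fin k := ⟨0, hk1⟩
      exact ⟨v j, hvS j, hWt t ht ▸ Submodule.subset_span ⟨hvS j, hlt j⟩, hv.ne_zero j,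
        (hlt j).trans (h.trans_lt hw2)⟩
  have htend : Filter.Tendsto (fun t => c * Real.exp (δ * t)) Filter.atTop Filter.atTop :=
    (Real.tendsto_exp_atTop.comp (Filter.tendsto_id.const_mul_atTop hδ)).const_mul_atTop hc
  obtain ⟨t, ht2, htT⟩ := ((htend.eventually_ge_atTop 2).and
    (Filter.eventually_ge_atTop (max T 0))).exists
  obtain ⟨w, hwS, hwW, hw0, hw2⟩ := hshort t htT
  have h1 := hexp t ((le_max_right _ _).trans htT) w hwW
  have h2 := one_le_norm_of_mem_intVectors hwS hw0
  have h3 : 2 * 1 ≤ c * Real.exp (δ * t) * ‖w‖ := by gcongr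
  exact absurd hw2 (not_lt.2 (by simpa using h3.trans h1))

end Lattice

section Pencil

lemma xTil_one_mulVec_apply {m : ℕ} (ξ : Fin m → ℝ) (w : Fin (m + 1) → ℝ) (i : Fin m) :
    (xTil m 1 (colMat m ξ) *ᵥ w) i = w (Fin.castSucc i) + ξ i * w (Fin.last m) := by
  have h1 : ∀ j : Fin m, uMat m 1 (colMat m ξ) (Fin.castAdd 1 i) (Fin.castSucc j) =
      (1 : Matrix (Fin m) (Fin m) ℝ) i j := fun j => by
    change uMat m 1 (colMat m ξ) (Fin.castAdd 1 i) (Fin.castAdd 1 j) = _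
    simp [uMat]
  have h2 : uMat m 1 (colMat m ξ) (Fin.castAdd 1 i) (Fin.last m) = ξ i := by
    change uMat m 1 (colMat m ξ) (Fin.castAdd 1 i) (Fin.natAdd m 0) = _
    simp [uMat, colMat]
  simp [Matrix.mulVec, dotProduct, xTil, Fin.sum_univ_castSucc, h1, h2, Matrix.one_apply]

lemma kerXtil_inf_eq_bot {m k : ℕ} {ξ : Fin m → ℝ} {nsel : Fin k → Fin m}
    (hind : LinearIndependent ℚ (Fin.cons (1 : ℝ) (fun i => ξ (nsel i)) : Fin (k + 1) → ℝ))
    {W : Submodule ℝ (Fin (m + 1) → ℝ)} (hrat : IsRationalSubspace W) (hdim : finrank ℝ W ≤ k) :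
    kerXtil m 1 (colMat m ξ) ⊓ W = ⊥ := by
  obtain ⟨S, rfl⟩ := hrat
  let e : Fin (k + 1) → Fin (m + 1) := Fin.cons (Fin.last m) fun i => (nsel i).castSucc
  let p : Submodule ℚ (Fin (k + 1) → ℚ) := Submodule.span ℚ ((fun q => q ∘ e) '' S)
  have hp : p < ⊤ := by
    refine lt_top_iff_ne_top.2 fun htop => hdim.not_gt ?_
    let W := Submodule.span ℝ ((fun q : Fin (m + 1) → ℚ => fun i => ((q i : ℝ))) '' S)
    let π : (Fin (m + 1) → ℝ) →ₗ[ℝ] (Fin (k + 1) → ℝ) := LinearMap.funLeft ℝ ℝ e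
    have hmem : ∀ q ∈ p, (fun i => (q i : ℝ)) ∈ W.map π := by
      intro q hq
      induction hq using Submodule.span_induction with
      | mem q hq =>
        obtain ⟨q, hq, rfl⟩ := hq
        exact ⟨_, Submodule.subset_span ⟨q, hq, rfl⟩, rfl⟩
      | zero =>
        convert (W.map π).zero_mem using 1
        funext i
        simp
      | add q r _ _ hq hr =>
        convert (W.map π).add_mem hq hr using 1
        funext i
        simp
      | smul a q _ hq =>
        convert (W.map π).smul_mem (a : ℝ) hq using 1
        funext i
        simp
    have hmap : W.map π = ⊤ := by
      rw [eq_top_iff, ← (Pi.basisFun ℝ (Fin (k + 1))).span_eq, Submodule.span_le]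
      rintro _ ⟨i, rfl⟩
      have h := hmem (Pi.single i 1) (htop ▸ Submodule.mem_top)
      rw [SetLike.mem_coe]
      convert h using 1
      funext j
      by_cases hj : j = i
      · subst hj; simp
      · simp [hj]
    have h := Submodule.finrank_map_le π W
    rw [hmap, finrank_top, finrank_fin_fun] at h
    exact h
  obtain ⟨f, hf0, hf⟩ := Submodule.exists_le_ker_of_lt_top p hp
  let c : Fin (k + 1) → ℚ := fun i => f (Pi.single i 1)
  have hfc : ∀ q, f q = ∑ i, c i * q i := by
    intro q
    conv_lhs => rw [pi_eq_sum_univ' q, map_sum]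
    refine Finset.sum_congr rfl fun i _ => ?_
    rw [map_smul, smul_eq_mul, mul_comm]
  have hW : ∀ w ∈ Submodule.span ℝ ((fun q : Fin (m + 1) → ℚ => fun i => ((q i : ℝ))) '' S),
      ∑ i, (c i : ℝ) * w (e i) = 0 := by
    intro w hw
    induction hw using Submodule.span_induction with
    | mem w hw =>
      obtain ⟨q, hq, rfl⟩ := hw
      have h : f (q ∘ e) = 0 := hf (Submodule.subset_span ⟨q, hq, rfl⟩)
      rw [hfc] at h
      change ∑ i, (c i : ℝ) * (q (e i) : ℝ) = 0
      exact_mod_cast h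
    | zero => simp
    | add v w _ _ hv hw => simp [mul_add, Finset.sum_add_distrib, hv, hw]
    | smul a w _ hw =>
      simp only [Pi.smul_apply, smul_eq_mul, mul_left_comm _ a, ← Finset.mul_sum, hw, mul_zero]
  rw [eq_bot_iff]
  rintro w ⟨hker, hw⟩
  have hcoord : ∀ i, w (Fin.castSucc i) = -(ξ i * w (Fin.last m)) := fun i => by
    have h : xTil m 1 (colMat m ξ) *ᵥ w = 0 := hker
    have := congrFun h i
    rw [xTil_one_mulVec_apply] at this
    exact eq_neg_of_add_eq_zero_left this
  have hlast : w (Fin.last m) = 0 := by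
    by_contra h0
    have hsum := hW w hw
    rw [Fin.sum_univ_succ] at hsum
    simp only [e, Fin.cons_zero, Fin.cons_succ, hcoord] at hsum
    let g : Fin (k + 1) → ℚ := Fin.cons (c 0) fun i => -c i.succ
    have hg : ∑ i, g i • (Fin.cons (1 : ℝ) (fun i => ξ (nsel i)) : Fin (k + 1) → ℝ) i = 0 := by
      rw [Fin.sum_univ_succ]
      simp only [g, Fin.cons_zero, Fin.cons_succ, Rat.smul_def, Rat.cast_neg]
      refine mul_right_cancel₀ h0 ?_
      rw [zero_mul, ← hsum, add_mul, Finset.sum_mul]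
      congr 1
      · ring
      · exact Finset.sum_congr rfl fun i _ => by ring
    have hg0 := Fintype.linearIndependent_iff.1 hind g hg
    refine hf0 (LinearMap.ext fun q => ?_)
    rw [hfc]
    refine Finset.sum_eq_zero fun i _ => ?_
    have : c i = 0 := by
      refine Fin.cases ?_ (fun i => ?_) i
      · simpa [g] using hg0 0
      · simpa [g] using hg0 i.succ
    rw [this, zero_mul]
  refine (Submodule.mem_bot ℝ).2 (funext fun i => ?_)
  refine Fin.lastCases ?_ (fun i => ?_) i
  · exact hlast
  · rw [hcoord, hlast]; simp

lemma psiF_bot (m : ℕ) {d : ℕ} (ω : Fin d → ℝ) : psiF m ω (⊥ : Submodule ℝ (Fin d → ℝ)) = 0 := by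
  refine Finset.sum_eq_zero fun i hi => ?_
  have h := (Finset.mem_filter.1 hi).2.2
  rw [bot_inf_eq, bot_inf_eq] at h
  exact absurd h (lt_irrefl _)

lemma Jset_nonempty {m : ℕ} {W : Submodule ℝ (Fin m → ℝ)} (hW : W ≠ ⊥) : (Jset W).Nonempty := by
  by_contra hJ
  rw [Finset.not_nonempty_iff_eq_empty] at hJ
  have hstep : ∀ j : Fin m,
      finrank ℝ ↥(W ⊓ Eprime m (j : ℕ)) ≤ finrank ℝ ↥(W ⊓ Eprime m ((j : ℕ) + 1)) := by
    intro j
    by_contra! h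
    have : j ∈ Jset W := by simpa [Jset] using h
    simp [hJ] at this
  have hle : ∀ j, j ≤ m → finrank ℝ ↥(W ⊓ Eprime m 0) ≤ finrank ℝ ↥(W ⊓ Eprime m j) := by
    intro j
    induction j with
    | zero => simp
    | succ j ih => exact fun hj => (ih (by omega)).trans (hstep ⟨j, hj⟩)
  have htop : Eprime m 0 = ⊤ := by
    rw [eq_top_iff, ← (Pi.basisFun ℝ (Fin m)).span_eq, Eprime]
    refine Submodule.span_mono ?_
    rintro _ ⟨i, rfl⟩
    exact ⟨i, Nat.zero_le _, by simp⟩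
  have hbot : Eprime m m = ⊥ := by
    rw [Eprime, Submodule.span_eq_bot]
    rintro _ ⟨i, hi, -⟩
    exact absurd i.is_lt (not_lt.2 hi)
  have h := hle m le_rfl
  rw [htop, hbot, inf_top_eq, inf_bot_eq, finrank_bot, Nat.le_zero,
    Submodule.finrank_eq_zero] at h
  exact hW h

lemma notMem_pencil {m n : ℕ} {ω : Fin (m + n) → ℝ} (hω : ∀ i, 0 < ω i)
    {x : Matrix (Fin m) (Fin n) ℝ} {W : Submodule ℝ (Fin (m + n) → ℝ)} (hW : W ≠ ⊥)
    (hx : kerXtil m n x ⊓ W = ⊥) {a b : ℝ} (hab : b ≤ a) : x ∉ pencil m n ω W a b := by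
  rintro ⟨ha, hb⟩
  rw [hx, psiF_bot] at ha
  have hmap : W.map (xTil m n x).mulVecLin ≠ ⊥ := by
    intro h
    have hle : W ≤ kerXtil m n x := Submodule.map_le_iff_le_comap.1 h.le
    exact hW (le_bot_iff.1 (hx ▸ le_inf hle le_rfl))
  have : 0 < phiF m n ω (W.map (xTil m n x).mulVecLin) :=
    Finset.sum_pos (fun j _ => hω _) (Jset_nonempty hmap)
  linarith

end Pencil

theorem connectedness_simultaneous_approx
    (m : ℕ) (hm : 1 ≤ m)
    (ω : Fin (m + 1) → ℝ) (hω : IsWeightVector m 1 ω)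
    (ξ : Fin m → ℝ) (k : ℕ) (hk1 : 1 ≤ k) (hk2 : k ≤ m)
    (nsel : Fin k → Fin m)
    (hind : LinearIndependent ℚ (Fin.cons (1 : ℝ) (fun i => ξ (nsel i)) : Fin (k + 1) → ℝ)) :
    (∀ (W : Submodule ℝ (Fin (m + 1) → ℝ)) (a b : ℝ),
        Module.finrank ℝ W = k → IsRationalSubspace W → b ≤ a →
        pencil m 1 ω W a b ≠ Set.univ →
        colMat m ξ ∉ pencil m 1 ω W a b) ∧
      ConnectedAt m ω (latticeOf (uMat m 1 (colMat m ξ))) k ∧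
      (LinearIndependent ℚ (Fin.cons (1 : ℝ) ξ : Fin (m + 1) → ℝ) →
        ∀ k' : ℕ, 1 ≤ k' → k' ≤ m →
          ConnectedAt m ω (latticeOf (uMat m 1 (colMat m ξ))) k') := by
  refine ⟨fun W a b hW hrat hab _ => ?_, ?_, fun hind' k' hk1' hk2' => ?_⟩
  · refine notMem_pencil hω.1 ?_ (kerXtil_inf_eq_bot hind hrat hW.le) hab
    rintro rfl
    rw [finrank_bot] at hW
    omega
  · exact connectedAt_of_disjoint hω _ hk1 (by omega) fun W hrat hdim =>
      kerXtil_inf_eq_bot hind hrat hdim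
  · have hsub : LinearIndependent ℚ
        (Fin.cons (1 : ℝ) (fun i => ξ (Fin.castLE hk2' i)) : Fin (k' + 1) → ℝ) := by
      convert hind'.comp _ (Fin.castLE_injective (Nat.succ_le_succ hk2')) using 1
      funext i
      refine Fin.cases ?_ (fun i => ?_) i <;> rfl
    exact connectedAt_of_disjoint hω _ hk1' (by omega) fun W hrat hdim =>
      kerXtil_inf_eq_bot hsub hrat hdim

end
end

section
/- Let d ≥ 2, m = d−1, n = 1, let k ∈ {1,…,d−1}, and let x = ᵗ(ξ_1,…,ξ_{d−1}) ∈ M_{d−1,1}(ℝ) be such that 1, ξ_1,…,ξ_k are linearly independent over ℚ. Then for every k-dimensional linear subspace W ⊂ ℝ^d spanned by vectors of ℤ^d, represented by v_W ∈ ⋀^k ℤ^d, there exists I ⊂ {1,…,d−1} of cardinality k such that the e_I-component of u(x)v_W in the standard basis of ⋀^k ℝ^d is nonzero. -/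
open scoped Classical
open MeasureTheory Module Matrix

noncomputable section

/-- A family of vectors in `K^k`, indexed by `Fin d`, whose members at the indices in `t` have
no common nonzero annihilator, has a nonzero `k × k` minor with rows in `t`. -/
lemma exists_finset_det_ne_zero {K : Type*} [Field K] {d k : ℕ} (f : Fin d → Fin k → K)
    (t : Set (Fin d)) (hf : ∀ c : Fin k → K, (∀ i ∈ t, ∑ j, f i j * c j = 0) → c = 0) :
    ∃ (I : Finset (Fin d)) (h : I.card = k), ↑I ⊆ t ∧
      (Matrix.of fun r c : Fin k => f (I.orderEmbOfFin h r) c).det ≠ 0 := by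
  obtain ⟨b, hbt, -, hspan, hli⟩ := exists_linearIndepOn_extension
    (linearIndepOn_empty K f) (Set.empty_subset t)
  have htop : Submodule.span K (f '' b) = ⊤ := by
    by_contra hne
    obtain ⟨φ, hφ, hle⟩ := Submodule.exists_le_ker_of_lt_top _ (lt_top_iff_ne_top.2 hne)
    have hsum (x : Fin k → K) : φ x = ∑ j, x j * φ (Pi.single j 1) := by
      rw [← Finset.univ_sum_single x, map_sum]
      refine Finset.sum_congr rfl fun j _ => ?_
      rw [Finset.univ_sum_single, ← smul_eq_mul, ← map_smul, ← Pi.single_smul, smul_eq_mul,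
        mul_one]
    have hc := hf (fun j => φ (Pi.single j 1)) fun i hi => by
      rw [← hsum]
      exact hle (hspan (Set.mem_image_of_mem f hi))
    refine hφ (LinearMap.ext fun x => ?_)
    rw [hsum]
    simp [fun j => congrFun hc j]
  have hcard : b.toFinset.card = k := by
    have h := finrank_span_eq_card hli
    rw [← Set.image_eq_range, htop, finrank_top, Module.finrank_fin_fun] at h
    rw [Set.toFinset_card, ← h]
  refine ⟨b.toFinset, hcard, by simpa using hbt, ?_⟩
  rw [← isUnit_iff_ne_zero, ← Matrix.isUnit_iff_isUnit_det,
    ← Matrix.linearIndependent_rows_iff_isUnit]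
  have hmem (r : Fin k) : b.toFinset.orderEmbOfFin hcard r ∈ b :=
    Set.mem_toFinset.1 (Finset.orderEmbOfFin_mem _ hcard r)
  exact hli.comp (fun r => (⟨_, hmem r⟩ : b)) fun r s hrs =>
    (b.toFinset.orderEmbOfFin hcard).injective (by simpa using hrs)

/-- Any `k` vectors in `K^(k+1)` are annihilated by a common nonzero linear form. -/
lemma exists_ne_zero_forall_sum_mul_eq_zero {K : Type*} [Field K] {k : ℕ}
    (z : Fin k → Fin (k + 1) → K) :
    ∃ a : Fin (k + 1) → K, a ≠ 0 ∧ ∀ j, ∑ i, z j i * a i = 0 := by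
  obtain ⟨a, ha, ha0⟩ := (Submodule.ne_bot_iff _).1
    (LinearMap.ker_ne_bot_of_finrank_lt (f := (Matrix.of z).mulVecLin) (by simp))
  exact ⟨a, ha0, fun j => congrFun ha j⟩

lemma uMat_colMat_mulVec_castSucc {m : ℕ} (ξ : Fin m → ℝ) (v : Fin (m + 1) → ℝ) (i : Fin m) :
    (uMat m 1 (colMat m ξ)).mulVec v i.castSucc = v i.castSucc + ξ i * v (Fin.last m) := by
  have hlast : finSumFinEquiv.symm (Fin.last m) = (Sum.inr 0 : Fin m ⊕ Fin 1) := by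
    rw [Equiv.symm_apply_eq]; rfl
  have hcast (l : Fin m) : finSumFinEquiv.symm l.castSucc = (Sum.inl l : Fin m ⊕ Fin 1) := by
    rw [Equiv.symm_apply_eq]; rfl
  rw [Matrix.mulVec, dotProduct, Fin.sum_univ_castSucc]
  simp [uMat, colMat, hcast, hlast, Matrix.one_apply]

/-- If `1, ξ_1, …, ξ_k` are linearly independent over `ℚ`, then a real combination of `k`
integer vectors lying in the line `{v : v_i + ξ_i v_{m+1} = 0 for all i ≤ m}` is zero. -/
lemma sum_mul_eq_zero_of_forall_add_mul_eq_zero {m k : ℕ} (hk : k ≤ m) (ξ : Fin m → ℝ)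
    (hind : LinearIndependent ℚ
      (Fin.cons (1 : ℝ) (fun i : Fin k => ξ (Fin.castLE hk i)) : Fin (k + 1) → ℝ))
    (z : Fin k → Fin (m + 1) → ℤ) (c : Fin k → ℝ)
    (hc : ∀ i : Fin m, ∑ j, (z j i.castSucc + ξ i * z j (Fin.last m)) * c j = 0)
    (i : Fin (m + 1)) : ∑ j, (z j i : ℝ) * c j = 0 := by
  set v : Fin (m + 1) → ℝ := fun i => ∑ j, (z j i : ℝ) * c j with hv
  have hvi (i : Fin m) : v i.castSucc = -ξ i * v (Fin.last m) := by
    have h := hc i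
    simp only [add_mul, Finset.sum_add_distrib, mul_assoc, ← Finset.mul_sum] at h
    linear_combination h
  have hvlast : v (Fin.last m) = 0 := by
    obtain ⟨a, ha0, ha⟩ := exists_ne_zero_forall_sum_mul_eq_zero (K := ℚ) fun j : Fin k =>
      (Fin.cons (z j (Fin.last m) : ℚ)
        (fun i : Fin k => (-z j (Fin.castLE hk i).castSucc : ℚ)) : Fin (k + 1) → ℚ)
    by_contra hne
    refine ha0 (funext (Fintype.linearIndependent_iff.1 hind a
      (mul_right_cancel₀ hne ?_)))
    have haj (j : Fin k) : (z j (Fin.last m) : ℝ) * a 0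
        - ∑ i : Fin k, (z j (Fin.castLE hk i).castSucc : ℝ) * a i.succ = 0 := by
      have h := ha j
      simp only [Fin.sum_univ_succ, Fin.cons_zero, Fin.cons_succ, neg_mul,
        Finset.sum_neg_distrib, ← sub_eq_add_neg] at h
      exact_mod_cast h
    have hva : v (Fin.last m) * a 0
        - ∑ i : Fin k, v (Fin.castLE hk i).castSucc * a i.succ = 0 := by
      simp only [hv, Finset.sum_mul]
      rw [Finset.sum_comm, ← Finset.sum_sub_distrib]
      refine Finset.sum_eq_zero fun j _ => ?_
      rw [← zero_mul (c j), ← haj j, sub_mul, Finset.sum_mul]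
      congr 1
      · ring
      · exact Finset.sum_congr rfl fun i _ => by ring
    rw [zero_mul, ← hva]
    simp only [Fin.sum_univ_succ, Fin.cons_zero, Fin.cons_succ, Rat.smul_def, hvi, add_mul,
      Finset.sum_mul, sub_eq_add_neg, ← Finset.sum_neg_distrib]
    congr 1
    · ring
    · exact Finset.sum_congr rfl fun i _ => by ring
  change v i = 0
  induction i using Fin.lastCases with
  | last => exact hvlast
  | cast i => rw [hvi, hvlast, mul_zero]

theorem exists_good_component_col
    (m : ℕ) (hm : 1 ≤ m) (k : ℕ) (hk1 : 1 ≤ k) (hk : k ≤ m)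
    (ξ : Fin m → ℝ)
    (hind : LinearIndependent ℚ
      (Fin.cons (1 : ℝ) (fun i : Fin k => ξ (Fin.castLE hk i)) : Fin (k + 1) → ℝ))
    (W : Submodule ℝ (Fin (m + 1) → ℝ)) (hW : Module.finrank ℝ W = k)
    (w : Fin k → (Fin (m + 1) → ℝ)) (hint : ∀ j i, ∃ z : ℤ, w j i = (z : ℝ))
    (hspan : Submodule.span ℝ (Set.range w) = W) :
    ∃ I : Finset (Fin (m + 1)), I.card = k ∧ (∀ i ∈ I, (i : ℕ) < m) ∧
      gramCoeff (fun j => (uMat m 1 (colMat m ξ)).mulVec (w j)) I ≠ 0 := by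
  choose z hz using hint
  have hli : LinearIndependent ℝ w := by
    rw [linearIndependent_iff_card_eq_finrank_span, Set.finrank, hspan, hW, Fintype.card_fin]
  obtain ⟨I, hI, hIm, hdet⟩ := exists_finset_det_ne_zero
    (fun i j => (uMat m 1 (colMat m ξ)).mulVec (w j) i) {i | (i : ℕ) < m} fun c hc => by
      refine funext (Fintype.linearIndependent_iff.1 hli c (funext fun i => ?_))
      have h := sum_mul_eq_zero_of_forall_add_mul_eq_zero hk ξ hind z c
        (fun i => by
          simpa only [uMat_colMat_mulVec_castSucc, hz] using hc i.castSucc i.is_lt) i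
      simpa [hz, mul_comm] using h
  refine ⟨I, hI, fun i hi => hIm hi, ?_⟩
  rwa [gramCoeff, dif_pos hI]

end
end
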